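/- arXiv:2209.11986 — 3 statements merged into one kernel-verified Lean document; each statement's English description precedes it below -/
import Mathlib

section
/- Let L be a Lie algebra over a field k. Every natural endomorphism α of the forgetful functor from the comma category L ↓ Lie_k to Lie_k is either the identity transformation (α_f = id for every morphism f : L → M) or the zero transformation (α_f = 0 for every f : L → M). -/
/-- An *extended (universal) endomorphism* of a Lie algebra `L` over `k`: a natural
endomorphism of the forgetful functor from the comma category `L ↓ Lie_k` to `Lie_k`,
i.e. an assignment, to every Lie algebra morphism `f : L → M`, of a Lie algebra
endomorphism `app M f : M → M`, natural in `f`. -/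
structure LieExtendedEndomorphism (k : Type u) [Field k]
    (L : Type u) [LieRing L] [LieAlgebra k L] : Type (u + 1) where
  app : ∀ (M : Type u) [LieRing M] [LieAlgebra k M], (L →ₗ⁅k⁆ M) → (M →ₗ⁅k⁆ M)
  naturality : ∀ (M : Type u) [LieRing M] [LieAlgebra k M]
    (N : Type u) [LieRing N] [LieAlgebra k N]
    (f : L →ₗ⁅k⁆ M) (g : M →ₗ⁅k⁆ N),
    g.comp (app M f) = (app N (g.comp f)).comp g


namespace LieExt

section Free

variable {k : Type*} [CommRing k]

/-- Lie subalgebra induction for the free Lie algebra. -/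
theorem free_induction {B : Type*} (S : LieSubalgebra k (FreeLieAlgebra k B))
    (h : ∀ b, FreeLieAlgebra.of k b ∈ S) (z : FreeLieAlgebra k B) : z ∈ S := by
  let g : FreeLieAlgebra k B →ₗ⁅k⁆ S := FreeLieAlgebra.lift k fun b => ⟨FreeLieAlgebra.of k b, h b⟩
  have hg : S.incl.comp g = LieHom.id := by
    ext b
    simp [g]
  have h2 : ((g z : S) : FreeLieAlgebra k B) = z := by
    have := LieHom.congr_fun hg z
    simpa using this
  rw [← h2]
  exact (g z).2

/-- The dual numbers over a Lie algebra. -/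
@[ext] structure Dbl (F : Type*) where
  fst : F
  snd : F

variable {F : Type*} [LieRing F] [LieAlgebra k F]

/-- Dual numbers are pairs. -/
def Dbl.toProd {F : Type*} : Dbl F ≃ F × F where
  toFun x := ⟨x.1, x.2⟩
  invFun x := ⟨x.1, x.2⟩
  left_inv _ := rfl
  right_inv _ := rfl

instance : AddCommGroup (Dbl F) := Dbl.toProd.addCommGroup
instance : Module k (Dbl F) := Dbl.toProd.module k
instance : Bracket (Dbl F) (Dbl F) where
  bracket x y := ⟨⁅x.1, y.1⁆, ⁅x.1, y.2⁆ + ⁅x.2, y.1⁆⟩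

@[simp] theorem Dbl.zero_eq : (0 : Dbl F) = ⟨0, 0⟩ := rfl
@[simp] theorem Dbl.add_eq (x y : Dbl F) : x + y = ⟨x.1 + y.1, x.2 + y.2⟩ := rfl
@[simp] theorem Dbl.smul_eq (c : k) (x : Dbl F) : c • x = ⟨c • x.1, c • x.2⟩ := rfl
@[simp] theorem Dbl.lie_eq (x y : Dbl F) : ⁅x, y⁆ = ⟨⁅x.1, y.1⁆, ⁅x.1, y.2⁆ + ⁅x.2, y.1⁆⟩ := rfl

instance : LieRing (Dbl F) where
  add_lie _ _ _ := by simp; abel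
  lie_add _ _ _ := by simp; abel
  lie_self x := by
    simp only [Dbl.lie_eq, lie_self, Dbl.zero_eq, Dbl.mk.injEq, true_and]
    rw [← lie_skew x.fst x.snd, neg_add_cancel]
  leibniz_lie _ _ _ := by
    simp only [Dbl.lie_eq, Dbl.add_eq, lie_add, add_lie, Dbl.mk.injEq]
    refine ⟨leibniz_lie _ _ _, ?_⟩
    simp only [lie_lie]
    abel

instance : LieAlgebra k (Dbl F) where
  lie_smul _ _ _ := by simp

/-- First projection. -/
def Dbl.proj : Dbl F →ₗ⁅k⁆ F where
  toFun x := x.1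
  map_add' _ _ := rfl
  map_smul' _ _ := rfl
  map_lie' := rfl

/-- The hom to dual numbers attached to prescribed values of a derivation. -/
noncomputable def derHom {B : Type*} (d : B → FreeLieAlgebra k B) :
    FreeLieAlgebra k B →ₗ⁅k⁆ Dbl (FreeLieAlgebra k B) :=
  FreeLieAlgebra.lift k fun b => ⟨FreeLieAlgebra.of k b, d b⟩

theorem derHom_fst {B : Type*} (d : B → FreeLieAlgebra k B) (z : FreeLieAlgebra k B) :
    (derHom d z).1 = z := by
  have : (Dbl.proj (k := k)).comp (derHom d) = LieHom.id := by
    ext b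
    simp only [derHom, LieHom.comp_apply, FreeLieAlgebra.lift_of_apply]
    rfl
  exact LieHom.congr_fun this z

/-- The derivation of a free Lie algebra with prescribed values on generators. -/
noncomputable def der {B : Type*} (d : B → FreeLieAlgebra k B) :
    LieDerivation k (FreeLieAlgebra k B) (FreeLieAlgebra k B) where
  toFun z := (derHom d z).2
  map_add' x y := by simp
  map_smul' c x := by simp
  leibniz' x y := by
    simp only [LinearMap.coe_mk, AddHom.coe_mk, LieHom.map_lie, Dbl.lie_eq, derHom_fst]
    rw [← lie_skew y]; abel

@[simp] theorem der_of {B : Type*} (d : B → FreeLieAlgebra k B) (b : B) :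
    der d (FreeLieAlgebra.of k b) = d b := by
  change (derHom d _).2 = _
  simp [derHom]

theorem der_ext {B : Type*} {D E : LieDerivation k (FreeLieAlgebra k B) (FreeLieAlgebra k B)}
    (h : ∀ b, D (FreeLieAlgebra.of k b) = E (FreeLieAlgebra.of k b)) : D = E := by
  ext z
  refine free_induction (k := k)
    { carrier := {z | D z = E z}, add_mem' := ?_, zero_mem' := ?_,
      smul_mem' := ?_, lie_mem' := ?_ } h z
  · intro a b ha hb
    simp only [Set.mem_ofPred_eq] at *
    simp [ha, hb]
  · simp
  · intro c a ha
    simp only [Set.mem_ofPred_eq] at *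
    simp [ha]
  · intro a b ha hb
    change D a = E a at ha
    change D b = E b at hb
    change D _ = E _
    simp [ha, hb]

end Free

section Univ

variable {k : Type*} [CommRing k] {L : Type*} [LieRing L] [LieAlgebra k L]
  {V : Type*} [AddCommGroup V] [Module k V] {B : Type*} (β : Module.Basis B k V)

/-- The inclusion of `V` into the free Lie algebra on a basis of `V`. -/
noncomputable def inc : V →ₗ[k] FreeLieAlgebra k B := β.constr k (FreeLieAlgebra.of k)

@[simp] theorem inc_basis (b : B) : inc β (β b) = FreeLieAlgebra.of k b := by simp [inc]

/-- A representation, given by a linear map. -/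
structure Rep (k L V : Type*) [CommRing k] [LieRing L] [LieAlgebra k L]
    [AddCommGroup V] [Module k V] where
  ρ : L →ₗ[k] V →ₗ[k] V
  map_lie : ∀ a b v, ρ ⁅a, b⁆ v = ρ a (ρ b v) - ρ b (ρ a v)

variable (r : Rep k L V)

theorem der_inc (T : V →ₗ[k] V) (v : V) :
    der (fun b => inc β (T (β b))) (inc β v) = inc β (T v) := by
  have : (der (fun b => inc β (T (β b)))).toLinearMap ∘ₗ inc β = inc β ∘ₗ T := by
    refine β.ext fun b => ?_
    simp
  exact LinearMap.congr_fun this v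

/-- The action by derivations. -/
noncomputable def act : L →ₗ⁅k⁆ LieDerivation k (FreeLieAlgebra k B) (FreeLieAlgebra k B) where
  toFun l := der fun b => inc β (r.ρ l (β b))
  map_add' x y := der_ext fun b => by simp
  map_smul' c x := der_ext fun b => by simp
  map_lie' {x y} := der_ext fun b => by
    simp [LieDerivation.lie_apply, r.map_lie, der_inc β (r.ρ _)]

@[simp] theorem act_inc (l : L) (v : V) : act β r l (inc β v) = inc β (r.ρ l v) :=
  der_inc β _ v

/-- The algebra `L ⋉ Free(V)`. -/
abbrev P := LieAlgebra.SemiDirectSum (FreeLieAlgebra k B) L (act β r)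

variable {M : Type*} [LieRing M] [LieAlgebra k M] (f : L →ₗ⁅k⁆ M)
  (t : V →ₗ[k] M)

/-- The map on the free Lie algebra induced by a linear map. -/
noncomputable def fmap : FreeLieAlgebra k B →ₗ⁅k⁆ M := FreeLieAlgebra.lift k fun b => t (β b)

@[simp] theorem fmap_of (b : B) : fmap β t (FreeLieAlgebra.of k b) = t (β b) := by simp [fmap]

@[simp] theorem fmap_inc (v : V) : fmap β t (inc β v) = t v := by
  have : (fmap β t).toLinearMap ∘ₗ inc β = t := β.ext fun b => by simp
  exact LinearMap.congr_fun this v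

theorem fmap_act (ht : ∀ l v, t (r.ρ l v) = ⁅f l, t v⁆) (l : L) (z : FreeLieAlgebra k B) :
    fmap β t (act β r l z) = ⁅f l, fmap β t z⁆ := by
  refine free_induction (k := k)
    { carrier := {z | fmap β t (act β r l z) = ⁅f l, fmap β t z⁆}, add_mem' := ?_, zero_mem' := ?_,
      smul_mem' := ?_, lie_mem' := ?_ } ?_ z
  · intro a b ha hb
    simp only [Set.mem_ofPred_eq] at *
    simp [ha, hb]
  · simp
  · intro c a ha
    simp only [Set.mem_ofPred_eq] at *
    simp [ha]
  · intro a b ha hb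
    change fmap β t (act β r l a) = _ at ha
    change fmap β t (act β r l b) = _ at hb
    change fmap β t (act β r l _) = _
    simp only [LieDerivation.apply_lie_eq_add, map_add, LieHom.map_lie, ha, hb]
    rw [leibniz_lie (f l)]; abel
  · intro b
    change fmap β t (act β r l _) = _
    rw [← inc_basis β, act_inc, fmap_inc, fmap_inc, ht]

/-- The universal map out of `L ⋉ Free(V)`. -/
noncomputable def umap (ht : ∀ l v, t (r.ρ l v) = ⁅f l, t v⁆) : P β r →ₗ⁅k⁆ M where
  toFun x := fmap β t x.left + f x.right
  map_add' x y := by simp; abel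
  map_smul' c x := by simp
  map_lie' {x y} := by
    simp only [LieAlgebra.SemiDirectSum.lie_eq_mk, map_add, map_sub, LieHom.map_lie,
      fmap_act β r f t ht, lie_add, add_lie]
    rw [← lie_skew (fmap β t x.left) (f y.right)]; abel

theorem umap_inl (ht : ∀ l v, t (r.ρ l v) = ⁅f l, t v⁆) (z : FreeLieAlgebra k B) :
    umap β r f t ht (LieAlgebra.SemiDirectSum.inl _ z) = fmap β t z := by
  simp [umap]

theorem umap_inr (ht : ∀ l v, t (r.ρ l v) = ⁅f l, t v⁆) (l : L) :
    umap β r f t ht (LieAlgebra.SemiDirectSum.inr _ l) = f l := by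
  simp [umap]

end Univ

section Split

variable {k : Type*} [CommRing k] {V : Type*} [AddCommGroup V] [Module k V] {B : Type*}
  (β : Module.Basis B k V)

open Classical in
/-- Kill all the generators outside of `S`. -/
noncomputable def res (k : Type*) [CommRing k] {B : Type*} (S : Set B) :
    FreeLieAlgebra k B →ₗ⁅k⁆ FreeLieAlgebra k B :=
  FreeLieAlgebra.lift k fun b => if b ∈ S then FreeLieAlgebra.of k b else 0

theorem res_res (S T : Set B) (z : FreeLieAlgebra k B) :
    res k S (res k T z) = res k (S ∩ T) z := by
  have : (res k S).comp (res k T) = res k (S ∩ T) := by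
    ext b
    by_cases h1 : b ∈ S <;> by_cases h2 : b ∈ T <;> simp [res, h1, h2]
  exact LieHom.congr_fun this z

theorem res_finite (z : FreeLieAlgebra k B) : ∃ S : Finset B, res k (S : Set B) z = z := by
  classical
  have mono : ∀ (S T : Finset B) (z : FreeLieAlgebra k B), S ⊆ T → res k (S : Set B) z = z →
      res k (T : Set B) z = z := by
    intro S T z h hz
    rw [← hz, res_res, Set.inter_eq_right.2 (by exact_mod_cast h)]
  refine free_induction (k := k)
    { carrier := {z | ∃ S : Finset B, res k (S : Set B) z = z}, add_mem' := ?_, zero_mem' := ?_,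
      smul_mem' := ?_, lie_mem' := ?_ } ?_ z
  · rintro a b ⟨S, hS⟩ ⟨T, hT⟩
    refine ⟨S ∪ T, ?_⟩
    rw [map_add, mono _ _ a Finset.subset_union_left hS, mono _ _ b Finset.subset_union_right hT]
  · exact ⟨∅, by simp⟩
  · rintro c a ⟨S, hS⟩
    exact ⟨S, by simp [hS]⟩
  · rintro a b ⟨S, hS⟩ ⟨T, hT⟩
    refine ⟨S ∪ T, ?_⟩
    rw [LieHom.map_lie, mono _ _ a Finset.subset_union_left hS,
      mono _ _ b Finset.subset_union_right hT]
  · intro b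
    exact ⟨{b}, by simp [res]⟩

theorem res_singleton (b : B) (z : FreeLieAlgebra k B) :
    ∃ c : k, res k ({b} : Set B) z = c • FreeLieAlgebra.of k b := by
  refine free_induction (k := k)
    { carrier := {z | ∃ c : k, res k ({b} : Set B) z = c • FreeLieAlgebra.of k b},
      add_mem' := ?_, zero_mem' := ?_, smul_mem' := ?_, lie_mem' := ?_ } ?_ z
  · rintro x y ⟨c, hc⟩ ⟨d, hd⟩
    exact ⟨c + d, by simp [hc, hd, add_smul]⟩
  · exact ⟨0, by simp⟩
  · rintro c a ⟨d, hd⟩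
    exact ⟨c * d, by simp [hd, mul_smul]⟩
  · rintro x y ⟨c, hc⟩ ⟨d, hd⟩
    exact ⟨0, by simp [hc, hd]⟩
  · intro b'
    by_cases h : b' = b
    · subst h
      exact ⟨1, by simp [res]⟩
    · exact ⟨0, by simp [res, h]⟩

theorem mem_range_of_res (z : FreeLieAlgebra k B)
    (h : ∀ S : Set B, z = res k S z + res k Sᶜ z) : z ∈ LinearMap.range (inc β) := by
  classical
  obtain ⟨S, hS⟩ := res_finite z
  rw [← hS]
  clear hS
  induction S using Finset.induction_on with
  | empty =>
    have : res k ((∅ : Finset B) : Set B) = 0 := by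
      ext b
      simp [res]
    rw [this]
    simp
  | insert b S hb ih =>
    rw [h {b}, map_add, res_res, res_res]
    have h1 : (((insert b S : Finset B) : Set B) ∩ {b}) = {b} := by
      ext x; simp
    have h2 : (((insert b S : Finset B) : Set B) ∩ {b}ᶜ) = S := by
      ext x; simp; grind
    rw [h1, h2]
    refine Submodule.add_mem _ ?_ ih
    obtain ⟨c, hc⟩ := res_singleton b z
    rw [hc]
    exact Submodule.smul_mem _ _ ⟨β b, by simp⟩

theorem mem_range_of_additive (z : FreeLieAlgebra k B)
    (h : fmap β (inc (β.prod β) ∘ₗ (LinearMap.inl k V V + LinearMap.inr k V V)) z =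
      fmap β (inc (β.prod β) ∘ₗ LinearMap.inl k V V) z +
      fmap β (inc (β.prod β) ∘ₗ LinearMap.inr k V V) z) : z ∈ LinearMap.range (inc β) := by
  classical
  refine mem_range_of_res β z fun S => ?_
  let ψ : FreeLieAlgebra k (B ⊕ B) →ₗ⁅k⁆ FreeLieAlgebra k B := FreeLieAlgebra.lift k
    (Sum.elim (fun b => if b ∈ S then FreeLieAlgebra.of k b else 0)
      (fun b => if b ∈ Sᶜ then FreeLieAlgebra.of k b else 0))
  have il : ∀ b, inc (β.prod β) (β b, 0) = FreeLieAlgebra.of k (Sum.inl b) := fun b => by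
    rw [← inc_basis (β.prod β)]
    congr 1
    ext <;> simp
  have ir : ∀ b, inc (β.prod β) (0, β b) = FreeLieAlgebra.of k (Sum.inr b) := fun b => by
    rw [← inc_basis (β.prod β)]
    congr 1
    ext <;> simp
  have h1 : ψ.comp (fmap β (inc (β.prod β) ∘ₗ LinearMap.inl k V V)) = res k S := by
    ext b
    simp [il, ψ, res]
  have h2 : ψ.comp (fmap β (inc (β.prod β) ∘ₗ LinearMap.inr k V V)) = res k Sᶜ := by
    ext b
    simp [ir, ψ, res]
  have h3 : ψ.comp (fmap β (inc (β.prod β) ∘ₗ (LinearMap.inl k V V + LinearMap.inr k V V)))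
      = LieHom.id := by
    ext b
    have e : inc (β.prod β) ((LinearMap.inl k V V + LinearMap.inr k V V) (β b)) =
        FreeLieAlgebra.of k (Sum.inl b) + FreeLieAlgebra.of k (Sum.inr b) := by
      rw [← il, ← ir, ← map_add]; simp
    rw [LieHom.comp_apply, fmap_of, LinearMap.comp_apply, e, map_add]
    by_cases hb : b ∈ S <;> simp [ψ, hb]
  have h4 := congrArg ψ h
  rw [map_add] at h4
  rw [← h1, ← h2]
  refine Eq.trans ?_ h4
  exact (LieHom.congr_fun h3 z).symm

end Split

section Env

attribute [local instance] LieRing.ofAssociativeRing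

universe u
variable {k : Type u} [Field k] {L : Type u} [LieRing L] [LieAlgebra k L]

/-- `U(L)` as an `L`-module. -/
noncomputable def repU (k L : Type u) [Field k] [LieRing L] [LieAlgebra k L] :
    Rep k L (UniversalEnvelopingAlgebra k L) where
  ρ := LinearMap.mul k _ ∘ₗ (UniversalEnvelopingAlgebra.ι k : L →ₗ⁅k⁆ _).toLinearMap
  map_lie a b v := by
    have := (UniversalEnvelopingAlgebra.ι k (L := L)).map_lie a b
    rw [LieRing.of_associative_ring_bracket] at this
    simp only [LinearMap.comp_apply, LieHom.coe_toLinearMap, LinearMap.mul_apply', this]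
    noncomm_ring

theorem repU_apply (l : L) (v : UniversalEnvelopingAlgebra k L) :
    (repU k L).ρ l v = UniversalEnvelopingAlgebra.ι k l * v := rfl

/-- `U(L) × U(L)` as an `L`-module. -/
noncomputable def repU2 (k L : Type u) [Field k] [LieRing L] [LieAlgebra k L] :
    Rep k L (UniversalEnvelopingAlgebra k L × UniversalEnvelopingAlgebra k L) where
  ρ :=
    { toFun := fun l => ((repU k L).ρ l).prodMap ((repU k L).ρ l)
      map_add' := fun a b => by ext <;> simp
      map_smul' := fun a b => by ext <;> simp }
  map_lie a b v := by
    ext <;> simp [(repU k L).map_lie]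

theorem repU2_apply (l : L) (v : UniversalEnvelopingAlgebra k L × UniversalEnvelopingAlgebra k L) :
    (repU2 k L).ρ l v =
      (UniversalEnvelopingAlgebra.ι k l * v.1, UniversalEnvelopingAlgebra.ι k l * v.2) := rfl

/-- The action of `U(L)` on `M`. -/
noncomputable def env {M : Type*} [LieRing M] [LieAlgebra k M] (f : L →ₗ⁅k⁆ M) :
    UniversalEnvelopingAlgebra k L →ₐ[k] Module.End k M :=
  UniversalEnvelopingAlgebra.lift k ((LieAlgebra.ad k M).comp f)

theorem env_ι_mul {M : Type*} [LieRing M] [LieAlgebra k M] (f : L →ₗ⁅k⁆ M) (l : L)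
    (v : UniversalEnvelopingAlgebra k L) (m : M) :
    env f (UniversalEnvelopingAlgebra.ι k l * v) m = ⁅f l, env f v m⁆ := by
  rw [map_mul, env, UniversalEnvelopingAlgebra.lift_ι_apply]
  rfl

/-- `v ↦ v • m`. -/
noncomputable def orb {M : Type*} [LieRing M] [LieAlgebra k M] (f : L →ₗ⁅k⁆ M) (m : M) :
    UniversalEnvelopingAlgebra k L →ₗ[k] M := (env f).toLinearMap.flip m

theorem orb_apply {M : Type*} [LieRing M] [LieAlgebra k M] (f : L →ₗ⁅k⁆ M) (m : M)
    (v : UniversalEnvelopingAlgebra k L) : orb f m v = env f v m := rfl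

/-- A basis of `U(L)`. -/
noncomputable abbrev bas (k L : Type u) [Field k] [LieRing L] [LieAlgebra k L] :=
  Module.Basis.ofVectorSpace k (UniversalEnvelopingAlgebra k L)

theorem nat_apply (α : LieExtendedEndomorphism k L) {M N : Type u} [LieRing M] [LieAlgebra k M]
    [LieRing N] [LieAlgebra k N] (f : L →ₗ⁅k⁆ M) (g : M →ₗ⁅k⁆ N) (h : L →ₗ⁅k⁆ N)
    (hh : g.comp f = h) (m : M) : g (α.app M f m) = α.app N h (g m) := by
  subst hh
  exact LieHom.congr_fun (α.naturality M N f g) m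

/-- The generic value. -/
noncomputable def gen (α : LieExtendedEndomorphism k L) : P (bas k L) (repU k L) :=
  α.app _ (LieAlgebra.SemiDirectSum.inr _) (LieAlgebra.SemiDirectSum.inl _ (inc (bas k L) 1))

theorem gen_eq (α : LieExtendedEndomorphism k L) :
    gen α = LieAlgebra.SemiDirectSum.inl _ (gen α).left := by
  have : (gen α).right = 0 := by
    have h := nat_apply α (LieAlgebra.SemiDirectSum.inr (act (bas k L) (repU k L)))
      (LieAlgebra.SemiDirectSum.projr (act (bas k L) (repU k L))) LieHom.id (by ext; rfl)
      (LieAlgebra.SemiDirectSum.inl _ (inc (bas k L) 1))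
    rw [LieAlgebra.SemiDirectSum.projr_inl_apply, map_zero] at h
    exact h
  apply LieAlgebra.SemiDirectSum.ext
  · rfl
  · exact this

theorem app_eq_fmap (α : LieExtendedEndomorphism k L) {M : Type u} [LieRing M] [LieAlgebra k M]
    (f : L →ₗ⁅k⁆ M) (t : UniversalEnvelopingAlgebra k L →ₗ[k] M)
    (ht : ∀ l v, t (UniversalEnvelopingAlgebra.ι k l * v) = ⁅f l, t v⁆) :
    α.app M f (t 1) = fmap (bas k L) t (gen α).left := by
  have h := nat_apply α (LieAlgebra.SemiDirectSum.inr (act (bas k L) (repU k L)))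
    (umap (bas k L) (repU k L) f t ht) f (by ext l; exact umap_inr _ _ _ _ ht l)
    (LieAlgebra.SemiDirectSum.inl _ (inc (bas k L) 1))
  have ht' : ∀ l v, t ((repU k L).ρ l v) = ⁅f l, t v⁆ := ht
  rw [umap_inl (bas k L) (repU k L) f t ht', fmap_inc] at h
  rw [← h, ← umap_inl (bas k L) (repU k L) f t ht, ← gen_eq]
  rfl

/-- Shorthand for `L ⋉ Free(U ⊕ U)`. -/
abbrev P2 (k L : Type u) [Field k] [LieRing L] [LieAlgebra k L] :=
  P ((bas k L).prod (bas k L)) (repU2 k L)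

theorem app_P2 (α : LieExtendedEndomorphism k L)
    (j : UniversalEnvelopingAlgebra k L →ₗ[k]
      UniversalEnvelopingAlgebra k L × UniversalEnvelopingAlgebra k L)
    (hj : ∀ l v, j (UniversalEnvelopingAlgebra.ι k l * v) = (repU2 k L).ρ l (j v)) :
    α.app (P2 k L) (LieAlgebra.SemiDirectSum.inr _)
      (LieAlgebra.SemiDirectSum.inl _ (inc ((bas k L).prod (bas k L)) (j 1))) =
      LieAlgebra.SemiDirectSum.inl _
        (fmap (bas k L) (inc ((bas k L).prod (bas k L)) ∘ₗ j) (gen α).left) := by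
  have h := app_eq_fmap α (LieAlgebra.SemiDirectSum.inr
      (act ((bas k L).prod (bas k L)) (repU2 k L)))
    ((LieAlgebra.SemiDirectSum.inl (act ((bas k L).prod (bas k L)) (repU2 k L))).toLinearMap ∘ₗ
      inc ((bas k L).prod (bas k L)) ∘ₗ j) (by
      intro l v
      rw [LinearMap.comp_apply, LinearMap.comp_apply, hj]
      simp)
  refine Eq.trans h ?_
  have : fmap (bas k L) ((LieAlgebra.SemiDirectSum.inl
      (act ((bas k L).prod (bas k L)) (repU2 k L))).toLinearMap ∘ₗ
      inc ((bas k L).prod (bas k L)) ∘ₗ j) =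
      (LieAlgebra.SemiDirectSum.inl (act ((bas k L).prod (bas k L)) (repU2 k L))).comp
        (fmap (bas k L) (inc ((bas k L).prod (bas k L)) ∘ₗ j)) := by
    apply FreeLieAlgebra.hom_ext
    intro b
    rw [LieHom.comp_apply, fmap_of, fmap_of]
    rfl
  rw [this]
  rfl

theorem exists_u (α : LieExtendedEndomorphism k L) :
    ∃ u : UniversalEnvelopingAlgebra k L, ∀ (M : Type u) [LieRing M] [LieAlgebra k M]
      (f : L →ₗ⁅k⁆ M) (m : M), α.app M f m = env f u m := by
  have key : (gen α).left ∈ LinearMap.range (inc (bas k L)) := by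
    apply mem_range_of_additive
    apply LieAlgebra.SemiDirectSum.inl_injective (act ((bas k L).prod (bas k L)) (repU2 k L))
    rw [map_add, ← app_P2, ← app_P2, ← app_P2, ← map_add, ← map_add, ← map_add]
    · rfl
    all_goals
      intro l v
      ext <;> simp [repU2_apply]
  obtain ⟨u, hu⟩ := key
  refine ⟨u, fun M _ _ f m => ?_⟩
  have h := app_eq_fmap α f (orb f m) (fun l v => env_ι_mul f l v m)
  rw [← hu, fmap_inc, orb_apply, orb_apply, map_one] at h
  exact h

theorem env_induction (S : Subalgebra k (UniversalEnvelopingAlgebra k L))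
    (h : ∀ l, UniversalEnvelopingAlgebra.ι k l ∈ S) (v : UniversalEnvelopingAlgebra k L) :
    v ∈ S := by
  let g0 : L →ₗ⁅k⁆ S :=
    { toFun := fun l => ⟨UniversalEnvelopingAlgebra.ι k l, h l⟩
      map_add' := fun a b => Subtype.ext (map_add (UniversalEnvelopingAlgebra.ι k) a b)
      map_smul' := fun c b => Subtype.ext (map_smul (UniversalEnvelopingAlgebra.ι k) c b)
      map_lie' := fun {a b} => Subtype.ext (LieHom.map_lie (UniversalEnvelopingAlgebra.ι k) a b) }
  have hg : S.val.comp (UniversalEnvelopingAlgebra.lift k g0) = AlgHom.id k _ := by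
    apply UniversalEnvelopingAlgebra.hom_ext
    ext l
    change ((UniversalEnvelopingAlgebra.lift k g0 (UniversalEnvelopingAlgebra.ι k l) : S) :
      UniversalEnvelopingAlgebra k L) = UniversalEnvelopingAlgebra.ι k l
    rw [UniversalEnvelopingAlgebra.lift_ι_apply]
    rfl
  have h2 := AlgHom.congr_fun hg v
  have h3 : ((UniversalEnvelopingAlgebra.lift k g0 v : S) : UniversalEnvelopingAlgebra k L) = v :=
    h2
  rw [← h3]
  exact Subtype.property _

theorem env_equivariant {M : Type*} [LieRing M] [LieAlgebra k M] (f : L →ₗ⁅k⁆ M)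
    (t : UniversalEnvelopingAlgebra k L →ₗ[k] M)
    (ht : ∀ l v, t (UniversalEnvelopingAlgebra.ι k l * v) = ⁅f l, t v⁆)
    (v : UniversalEnvelopingAlgebra k L) : env f v (t 1) = t v := by
  let S : Subalgebra k (UniversalEnvelopingAlgebra k L) :=
    { carrier := {v | ∀ a, env f v (t a) = t (v * a)}
      mul_mem' := by
        intro x y hx hy a
        rw [map_mul, Module.End.mul_apply, hy, hx, mul_assoc]
      add_mem' := by
        intro x y hx hy a
        rw [map_add, LinearMap.add_apply, hy, hx, add_mul, map_add]
      algebraMap_mem' := by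
        intro c a
        rw [AlgHom.commutes, Module.algebraMap_end_apply, ← Algebra.smul_def, map_smul] }
  have : v ∈ S := by
    refine env_induction S (fun l a => ?_) v
    have := env_ι_mul f l 1 (t a)
    rw [mul_one, map_one, Module.End.one_apply] at this
    rw [this, ht]
  have h := this 1
  rwa [mul_one] at h

/-- The degree one part of the filtration. -/
noncomputable def fil (k L : Type u) [Field k] [LieRing L] [LieAlgebra k L] :
    Submodule k (UniversalEnvelopingAlgebra k L) :=
  1 ⊔ LinearMap.range (UniversalEnvelopingAlgebra.ι k : L →ₗ⁅k⁆ _).toLinearMap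

theorem one_le_fil : (1 : Submodule k (UniversalEnvelopingAlgebra k L)) ≤ fil k L := le_sup_left

theorem ι_mem_fil (l : L) : UniversalEnvelopingAlgebra.ι k l ∈ fil k L :=
  (le_sup_right : _ ≤ fil k L) ⟨l, rfl⟩

theorem fil_mono {i j : ℕ} (h : i ≤ j) : fil k L ^ i ≤ fil k L ^ j :=
  pow_le_pow_right₀ one_le_fil h

theorem exists_mem_fil (v : UniversalEnvelopingAlgebra k L) : ∃ n : ℕ, v ∈ fil k L ^ n := by
  let S : Subalgebra k (UniversalEnvelopingAlgebra k L) :=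
    { carrier := {v | ∃ n : ℕ, v ∈ fil k L ^ n}
      mul_mem' := by
        rintro x y ⟨n, hn⟩ ⟨m, hm⟩
        exact ⟨n + m, by rw [pow_add]; exact Submodule.mul_mem_mul hn hm⟩
      add_mem' := by
        rintro x y ⟨n, hn⟩ ⟨m, hm⟩
        exact ⟨n + m, Submodule.add_mem _ (fil_mono (Nat.le_add_right _ _) hn)
          (fil_mono (Nat.le_add_left _ _) hm)⟩
      algebraMap_mem' := by
        intro c
        exact ⟨0, by rw [pow_zero]; exact Submodule.algebraMap_mem c⟩ }
  exact env_induction S (fun l => ⟨1, by rw [pow_one]; exact ι_mem_fil l⟩) v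

/-- Shorthand for the bracket of the two components. -/
noncomputable def br (a b : UniversalEnvelopingAlgebra k L) :
    FreeLieAlgebra k (Module.Basis.ofVectorSpaceIndex k (UniversalEnvelopingAlgebra k L) ⊕
      Module.Basis.ofVectorSpaceIndex k (UniversalEnvelopingAlgebra k L)) :=
  ⁅inc ((bas k L).prod (bas k L)) (a, 0), inc ((bas k L).prod (bas k L)) (0, b)⁆

/-- The filtration on brackets. -/
noncomputable def T (k L : Type u) [Field k] [LieRing L] [LieAlgebra k L] (n : ℕ) :
    Submodule k (FreeLieAlgebra k
      (Module.Basis.ofVectorSpaceIndex k (UniversalEnvelopingAlgebra k L) ⊕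
      Module.Basis.ofVectorSpaceIndex k (UniversalEnvelopingAlgebra k L))) :=
  Submodule.span k {z | ∃ i j a b, i + j = n ∧ a ∈ fil k L ^ i ∧ b ∈ fil k L ^ j ∧ z = br a b}

theorem T_mono (n : ℕ) : T k L n ≤ T k L (n + 1) := by
  refine Submodule.span_le.2 ?_
  rintro z ⟨i, j, a, b, h, ha, hb, rfl⟩
  exact Submodule.subset_span ⟨i + 1, j, a, b, by omega, fil_mono (Nat.le_succ _) ha, hb, rfl⟩

theorem act_T (n : ℕ) (l : L) (z) (hz : z ∈ T k L n) :
    act ((bas k L).prod (bas k L)) (repU2 k L) l z ∈ T k L (n + 1) := by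
  have : T k L n ≤ (T k L (n + 1)).comap
      (act ((bas k L).prod (bas k L)) (repU2 k L) l).toLinearMap := by
    refine Submodule.span_le.2 ?_
    rintro z ⟨i, j, a, b, h, ha, hb, rfl⟩
    change act ((bas k L).prod (bas k L)) (repU2 k L) l (br a b) ∈ T k L (n + 1)
    rw [br, LieDerivation.apply_lie_eq_add, act_inc, act_inc, repU2_apply, repU2_apply]
    simp only [mul_zero]
    refine Submodule.add_mem _ (Submodule.subset_span ?_) (Submodule.subset_span ?_)
    · refine ⟨i, j + 1, a, _, by omega, ha, ?_, rfl⟩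
      rw [pow_succ']
      exact Submodule.mul_mem_mul (ι_mem_fil l) hb
    · refine ⟨i + 1, j, _, b, by omega, ?_, hb, rfl⟩
      rw [pow_succ']
      exact Submodule.mul_mem_mul (ι_mem_fil l) ha
  exact this hz

theorem env_br (n : ℕ) : ∀ a ∈ fil k L ^ n, ∃ z ∈ T k L n,
    env (LieAlgebra.SemiDirectSum.inr (act ((bas k L).prod (bas k L)) (repU2 k L))) a
      (LieAlgebra.SemiDirectSum.inl _ (br 1 1)) = LieAlgebra.SemiDirectSum.inl _ z := by
  induction n with
  | zero =>
    intro a ha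
    rw [pow_zero, Submodule.mem_one] at ha
    obtain ⟨c, rfl⟩ := ha
    refine ⟨c • br 1 1, Submodule.smul_mem _ _ (Submodule.subset_span
      ⟨0, 0, 1, 1, rfl, ?_, ?_, rfl⟩), ?_⟩
    · rw [pow_zero]; exact Submodule.mem_one.2 ⟨1, map_one _⟩
    · rw [pow_zero]; exact Submodule.mem_one.2 ⟨1, map_one _⟩
    · rw [AlgHom.commutes, Module.algebraMap_end_apply, map_smul]
  | succ n ih =>
    intro a ha
    rw [pow_succ'] at ha
    refine Submodule.mul_induction_on ha ?_ ?_
    · intro w hw v hv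
      obtain ⟨z, hz, e⟩ := ih v hv
      obtain ⟨p, hp, q, ⟨l, rfl⟩, rfl⟩ := Submodule.mem_sup.1 hw
      obtain ⟨c, rfl⟩ := Submodule.mem_one.1 hp
      refine ⟨c • z + act ((bas k L).prod (bas k L)) (repU2 k L) l z,
        Submodule.add_mem _ (Submodule.smul_mem _ _ (T_mono n hz)) (act_T n l z hz), ?_⟩
      rw [add_mul, map_add, LinearMap.add_apply, map_mul, AlgHom.commutes, Module.End.mul_apply,
        Module.algebraMap_end_apply, LieHom.coe_toLinearMap, env_ι_mul, e, map_add, map_smul]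
      congr 1
      simp
    · rintro x y ⟨z, hz, e⟩ ⟨z', hz', e'⟩
      exact ⟨z + z', Submodule.add_mem _ hz hz', by rw [map_add, LinearMap.add_apply, e, e', map_add]⟩

/-- Test map to `3 × 3` matrices. -/
noncomputable def test (φ : UniversalEnvelopingAlgebra k L →ₗ[k] k) :
    FreeLieAlgebra k (Module.Basis.ofVectorSpaceIndex k (UniversalEnvelopingAlgebra k L) ⊕
      Module.Basis.ofVectorSpaceIndex k (UniversalEnvelopingAlgebra k L)) →ₗ⁅k⁆
      Matrix (Fin 3) (Fin 3) k :=
  fmap ((bas k L).prod (bas k L))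
    ((Matrix.singleLinearMap k 0 1 ∘ₗ φ).coprod (Matrix.singleLinearMap k 1 2 ∘ₗ φ))

theorem test_br (φ : UniversalEnvelopingAlgebra k L →ₗ[k] k) (a b : UniversalEnvelopingAlgebra k L) :
    test φ (br a b) 0 2 = φ a * φ b := by
  rw [br, LieHom.map_lie, test, fmap_inc, fmap_inc, LieRing.of_associative_ring_bracket]
  simp [Matrix.sub_apply]

theorem scalar_of_mul (u : UniversalEnvelopingAlgebra k L)
    (hu : env (LieAlgebra.SemiDirectSum.inr (act ((bas k L).prod (bas k L)) (repU2 k L))) u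
      (LieAlgebra.SemiDirectSum.inl _ (br 1 1)) = LieAlgebra.SemiDirectSum.inl _ (br u u)) :
    ∃ c : k, u = algebraMap k _ c := by
  classical
  have hex := exists_mem_fil u
  have hn := Nat.find_spec hex
  obtain ⟨z, hz, e⟩ := env_br _ u hn
  have hz2 : br u u = z := LieAlgebra.SemiDirectSum.inl_injective _ (hu.symm.trans e)
  rcases hm : Nat.find hex with _ | m
  · rw [hm, pow_zero, Submodule.mem_one] at hn
    obtain ⟨c, hc⟩ := hn
    exact ⟨c, hc.symm⟩
  · exfalso
    have hnot : u ∉ fil k L ^ m := Nat.find_min hex (by omega)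
    obtain ⟨φ, h1, h2⟩ := Submodule.exists_le_ker_of_notMem hnot
    rw [hm] at hz
    have hker : T k L (m + 1) ≤ LinearMap.ker
        (Matrix.entryLinearMap k k (0 : Fin 3) (2 : Fin 3) ∘ₗ (test φ).toLinearMap) := by
      refine Submodule.span_le.2 ?_
      rintro z ⟨i, j, a, b, h, ha, hb, rfl⟩
      change test φ (br a b) 0 2 = 0
      rw [test_br]
      by_cases hi : i ≤ m
      · rw [LinearMap.mem_ker.1 (h2 (fil_mono hi ha)), zero_mul]
      · rw [LinearMap.mem_ker.1 (h2 (fil_mono (by omega) hb)), mul_zero]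
    have h3 : test φ z 0 2 = 0 := hker hz
    rw [← hz2, test_br] at h3
    exact h1 (mul_self_eq_zero.1 h3)

theorem main (α : LieExtendedEndomorphism k L) : ∃ c : k, (c = 0 ∨ c = 1) ∧
    ∀ (M : Type u) [LieRing M] [LieAlgebra k M] (f : L →ₗ⁅k⁆ M) (m : M), α.app M f m = c • m := by
  obtain ⟨u, hu⟩ := exists_u α
  have h1 : ∀ j : UniversalEnvelopingAlgebra k L →ₗ[k]
      UniversalEnvelopingAlgebra k L × UniversalEnvelopingAlgebra k L,
      (∀ l v, j (UniversalEnvelopingAlgebra.ι k l * v) = (repU2 k L).ρ l (j v)) →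
      env (LieAlgebra.SemiDirectSum.inr (act ((bas k L).prod (bas k L)) (repU2 k L))) u
        (LieAlgebra.SemiDirectSum.inl _ (inc ((bas k L).prod (bas k L)) (j 1))) =
        LieAlgebra.SemiDirectSum.inl _ (inc ((bas k L).prod (bas k L)) (j u)) := by
    intro j hj
    refine env_equivariant (LieAlgebra.SemiDirectSum.inr
      (act ((bas k L).prod (bas k L)) (repU2 k L)))
      ((LieAlgebra.SemiDirectSum.inl (act ((bas k L).prod (bas k L)) (repU2 k L))).toLinearMap ∘ₗ
      inc ((bas k L).prod (bas k L)) ∘ₗ j) ?_ u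
    intro l v
    rw [LinearMap.comp_apply, LinearMap.comp_apply, hj]
    simp
  have hbr : env (LieAlgebra.SemiDirectSum.inr (act ((bas k L).prod (bas k L)) (repU2 k L))) u
      (LieAlgebra.SemiDirectSum.inl _ (br 1 1)) = LieAlgebra.SemiDirectSum.inl _ (br u u) := by
    have hl := h1 (LinearMap.inl k _ _) (fun l v => by ext <;> simp [repU2_apply])
    have hr := h1 (LinearMap.inr k _ _) (fun l v => by ext <;> simp [repU2_apply])
    rw [← hu] at hl hr ⊢
    rw [br, LieHom.map_lie, LieHom.map_lie]
    rw [LinearMap.inl_apply, LinearMap.inl_apply] at hl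
    rw [LinearMap.inr_apply, LinearMap.inr_apply] at hr
    rw [hl, hr, br, LieHom.map_lie]
  obtain ⟨c, rfl⟩ := scalar_of_mul u hbr
  refine ⟨c, ?_, fun M _ _ f m => ?_⟩
  · rw [AlgHom.commutes, Module.algebraMap_end_apply, ← map_smul] at hbr
    have h2 := LieAlgebra.SemiDirectSum.inl_injective _ hbr
    let φ : UniversalEnvelopingAlgebra k L →ₐ[k] k :=
      UniversalEnvelopingAlgebra.lift k (0 : L →ₗ⁅k⁆ k)
    have h3 := congrArg (fun z => test φ.toLinearMap z 0 2) h2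
    simp only [map_smul, Matrix.smul_apply, test_br, AlgHom.toLinearMap_apply, AlgHom.commutes,
      map_one] at h3
    simp only [Algebra.algebraMap_self, RingHom.id_apply, smul_eq_mul, mul_one] at h3
    by_cases hc : c = 0
    · exact Or.inl hc
    · exact Or.inr (mul_left_cancel₀ hc (by rw [mul_one]; exact h3.symm))
  · rw [hu, AlgHom.commutes, Module.algebraMap_end_apply]

end Env

end LieExt

/-- Every natural endomorphism of the forgetful functor
`L ↓ Lie_k → Lie_k` is either the identity transformation or the zero transformation. -/
theorem lieExtendedEndomorphism_eq_id_or_zero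
    (k : Type u) [Field k] (L : Type u) [LieRing L] [LieAlgebra k L]
    (α : LieExtendedEndomorphism k L) :
    (∀ (M : Type u) [LieRing M] [LieAlgebra k M] (f : L →ₗ⁅k⁆ M),
        α.app M f = LieHom.id) ∨
    (∀ (M : Type u) [LieRing M] [LieAlgebra k M] (f : L →ₗ⁅k⁆ M),
        α.app M f = 0) := by
  obtain ⟨c, hc, h⟩ := LieExt.main α
  rcases hc with rfl | rfl
  · right
    intro M _ _ f
    ext m
    rw [h, zero_smul]
    rfl
  · left
    intro M _ _ f
    ext m
    rw [h, one_smul]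
    rfl
end

section
/- Let L be a Lie algebra over a field k. The map sending a ∈ L to the family of derivations (∂_{a,f})_f, where ∂_{a,f}(m) = [f(a), m] for every Lie algebra morphism f : L → M and m ∈ M, is an injective linear map from L into the space of extended derivations of L; in characteristic zero it is a linear bijection onto the space of all extended derivations. -/
set_option maxRecDepth 4000

/-- An *extended derivation* of a Lie algebra `L` over `k`: an assignment, to every Lie
algebra morphism `f : L → M`, of a derivation `d M f` of `M`, natural in `f` (for a
commuting triangle `g ∘ f = h` one has `g ∘ d_f = d_h ∘ g`). -/
structure LieExtendedDerivation (k : Type u) [Field k]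
    (L : Type u) [LieRing L] [LieAlgebra k L] : Type (u + 1) where
  d : ∀ (M : Type u) [LieRing M] [LieAlgebra k M], (L →ₗ⁅k⁆ M) → (M →ₗ[k] M)
  leibniz : ∀ (M : Type u) [LieRing M] [LieAlgebra k M] (f : L →ₗ⁅k⁆ M) (m m' : M),
    d M f ⁅m, m'⁆ = ⁅d M f m, m'⁆ + ⁅m, d M f m'⁆
  naturality : ∀ (M : Type u) [LieRing M] [LieAlgebra k M]
    (N : Type u) [LieRing N] [LieAlgebra k N]
    (f : L →ₗ⁅k⁆ M) (g : M →ₗ⁅k⁆ N) (m : M),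
    g (d M f m) = d N (g.comp f) (g m)

/-- The extended derivation `∂_{a,f} = [f a, -]` attached to an element `a ∈ L`. -/
def innerLieExtendedDerivation (k : Type u) [Field k]
    (L : Type u) [LieRing L] [LieAlgebra k L] (a : L) :
    LieExtendedDerivation k L where
  d M _ _ f := LieAlgebra.ad k M (f a)
  leibniz M _ _ f m m' := by
    simpa only [LieAlgebra.ad_apply] using leibniz_lie (f a) m m'
  naturality M _ _ N _ _ f g m := by
    simp only [LieAlgebra.ad_apply, LieHom.map_lie, LieHom.coe_comp, Function.comp_apply]

set_option linter.unusedSectionVars false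

namespace PBWAux

open Finsupp

variable {k : Type u} [Field k] {L : Type u} [LieRing L] [LieAlgebra k L]
  {X : Type u} [LinearOrder X] (b : Module.Basis X k L)

/-- The symmetric-algebra-like space: finitely supported functions on multisets. -/
abbrev S (k : Type u) [Field k] (X : Type u) : Type u := Multiset X →₀ k

/-- Basis element attached to a multiset. -/
noncomputable abbrev e (k : Type u) [Field k] {X : Type u} (w : Multiset X) : S k X :=
  Finsupp.single w 1

/-- `y` is a minimum of `w`, strictly below `x`. -/
def IsLow (x : X) (w : Multiset X) (y : X) : Prop := y ∈ w ∧ y < x ∧ ∀ z ∈ w, y ≤ z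

open Classical in
/-- The approximations to the action. -/
noncomputable def op : ℕ → (L →ₗ[k] Module.End k (S k X))
  | 0 => b.constr k (fun x => Finsupp.linearCombination k (fun w => e k (x ::ₘ w)))
  | n + 1 => b.constr k (fun x => Finsupp.linearCombination k (fun w =>
      if h : ∃ y, IsLow x w y then
        e k (x ::ₘ w)
        + op n (b h.choose) (op n (b x) (e k (w.erase h.choose)) - e k (x ::ₘ w.erase h.choose))
        + op n ⁅b x, b h.choose⁆ (e k (w.erase h.choose))
      else e k (x ::ₘ w)))

lemma op_zero (x : X) (w : Multiset X) : op b 0 (b x) (e k w) = e k (x ::ₘ w) := by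
  simp [op]

lemma op_succ_of_le (n : ℕ) (x : X) (w : Multiset X) (h : ∀ z ∈ w, x ≤ z) :
    op b (n + 1) (b x) (e k w) = e k (x ::ₘ w) := by
  have : ¬ ∃ y, IsLow x w y := by
    rintro ⟨y, hy, hlt, -⟩
    exact absurd (h y hy) (not_le.2 hlt)
  simp [op, this]

lemma op_succ_of_lt (n : ℕ) (x y : X) (w : Multiset X) (hyx : y < x) (h : ∀ z ∈ w, y ≤ z) :
    op b (n + 1) (b x) (e k (y ::ₘ w)) = e k (x ::ₘ y ::ₘ w)
      + op b n (b y) (op b n (b x) (e k w) - e k (x ::ₘ w)) + op b n ⁅b x, b y⁆ (e k w) := by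
  have hl : IsLow x (y ::ₘ w) y := ⟨by simp, hyx, by simpa using h⟩
  have hex : ∃ y', IsLow x (y ::ₘ w) y' := ⟨y, hl⟩
  have hc : hex.choose = y :=
    le_antisymm (hex.choose_spec.2.2 y hl.1) (hl.2.2 _ hex.choose_spec.1)
  simp only [op, Module.Basis.constr_basis, Finsupp.linearCombination_single, one_smul]
  rw [dif_pos hex, hc, Multiset.erase_cons_head]

/-- Either `x` is below `w` or `w` has a minimum below `x`. -/
lemma low_cases (x : X) (w : Multiset X) :
    (∀ z ∈ w, x ≤ z) ∨ ∃ y v, w = y ::ₘ v ∧ y < x ∧ ∀ z ∈ v, y ≤ z := by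
  by_cases h : ∀ z ∈ w, x ≤ z
  · exact Or.inl h
  · right
    push Not at h
    obtain ⟨z, hz, hzx⟩ := h
    have hne : w.toFinset.Nonempty := ⟨z, by simpa using hz⟩
    have hm : w.toFinset.min' hne ∈ w := by
      have := Finset.min'_mem _ hne
      simpa using this
    refine ⟨w.toFinset.min' hne, w.erase (w.toFinset.min' hne), (Multiset.cons_erase hm).symm,
      lt_of_le_of_lt (Finset.min'_le _ _ (by simpa using hz)) hzx, fun z' hz2 =>
      Finset.min'_le _ _ (by simpa using Multiset.mem_of_mem_erase hz2)⟩

/-- The filtration. -/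
noncomputable def F (k : Type u) [Field k] (X : Type u) (m : ℕ) : Submodule k (S k X) :=
  Submodule.span k (Set.image (fun w => e k w) {w : Multiset X | w.card ≤ m})

lemma e_mem {w : Multiset X} {m : ℕ} (h : w.card ≤ m) : e k w ∈ F k X m :=
  Submodule.subset_span ⟨w, h, rfl⟩

lemma F_mono {m n : ℕ} (h : m ≤ n) : F k X m ≤ F k X n :=
  Submodule.span_mono (Set.image_mono fun _ hw => le_trans hw h)

lemma exists_mem_F (v : S k X) : ∃ m, v ∈ F k X m := by
  induction v using Finsupp.induction_linear with
  | zero => exact ⟨0, zero_mem _⟩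
  | add f g hf hg =>
    obtain ⟨m, hm⟩ := hf
    obtain ⟨n, hn⟩ := hg
    exact ⟨max m n, add_mem (F_mono (le_max_left _ _) hm) (F_mono (le_max_right _ _) hn)⟩
  | single w c =>
    refine ⟨w.card, ?_⟩
    have : single w c = c • e k w := by simp
    rw [this]
    exact Submodule.smul_mem _ _ (e_mem le_rfl)

/-- Two linear maps agreeing on basis elements agree on the filtration step. -/
lemma eq_of_F {V : Type*} [AddCommGroup V] [Module k V] (f g : S k X →ₗ[k] V) (m : ℕ)
    (h : ∀ w : Multiset X, w.card ≤ m → f (e k w) = g (e k w)) {v : S k X} (hv : v ∈ F k X m) :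
    f v = g v := by
  have : F k X m ≤ LinearMap.eqLocus f g := by
    refine Submodule.span_le.2 ?_
    rintro _ ⟨w, hw, rfl⟩
    exact h w hw
  exact this hv

lemma mem_of_basis (W : Submodule k L) (h : ∀ x, b x ∈ W) (l : L) : l ∈ W := by
  have : Submodule.span k (Set.range b) ≤ W := Submodule.span_le.2 (by rintro _ ⟨x, rfl⟩; exact h x)
  exact this (b.mem_span l)

lemma map_mem_F (A : L →ₗ[k] Module.End k (S k X)) (m : ℕ)
    (h : ∀ x w, w.card ≤ m → A (b x) (e k w) - e k (x ::ₘ w) ∈ F k X w.card) (l : L)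
    {v : S k X} (hv : v ∈ F k X m) : A l v ∈ F k X (m + 1) := by
  have hle : F k X m ≤ (F k X (m + 1)).comap (A l) := by
    refine Submodule.span_le.2 ?_
    rintro _ ⟨w, hw, rfl⟩
    refine mem_of_basis b ((F k X (m + 1)).comap (A.flip (e k w))) (fun x => ?_) l
    change A (b x) (e k w) ∈ F k X (m + 1)
    have h1 := F_mono (k := k) (X := X) (le_trans hw (Nat.le_succ m)) (h x w hw)
    have h2 : e k (x ::ₘ w) ∈ F k X (m + 1) := e_mem (by simpa using hw)
    simpa using add_mem h1 h2
  exact hle hv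

lemma op_lead (n : ℕ) : ∀ x w, op b n (b x) (e k w) - e k (x ::ₘ w) ∈ F k X w.card := by
  induction n with
  | zero => intro x w; simp [op_zero]
  | succ n ih =>
    intro x w
    rcases low_cases x w with h | ⟨y, v, rfl, hyx, hv⟩
    · simp [op_succ_of_le b n x w h]
    · rw [op_succ_of_lt b n x y v hyx hv, add_assoc, add_sub_cancel_left, Multiset.card_cons]
      exact add_mem (map_mem_F b (op b n) _ (fun x w _ => ih x w) _ (ih x v))
        (map_mem_F b (op b n) _ (fun x w _ => ih x w) _ (e_mem le_rfl))

lemma op_mem (n : ℕ) (l : L) {m : ℕ} {v : S k X} (hv : v ∈ F k X m) :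
    op b n l v ∈ F k X (m + 1) :=
  map_mem_F b (op b n) _ (fun x w _ => op_lead b n x w) _ hv

/-- two families agreeing on basis elements -/
lemma agree (A B : L →ₗ[k] Module.End k (S k X)) (m : ℕ)
    (h : ∀ x w, w.card ≤ m → A (b x) (e k w) = B (b x) (e k w)) (l : L)
    {v : S k X} (hv : v ∈ F k X m) : A l v = B l v := by
  refine eq_of_F (A l) (B l) m (fun w hw => ?_) hv
  exact mem_of_basis b (LinearMap.eqLocus (A.flip (e k w)) (B.flip (e k w)))
    (fun x => h x w hw) l

lemma op_stable_succ (n : ℕ) : ∀ (l : L) (v : S k X), v ∈ F k X n →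
    op b (n + 1) l v = op b n l v := by
  induction n with
  | zero =>
    intro l v hv
    refine agree b _ _ 0 (fun x w hw => ?_) l hv
    have : w = 0 := by simpa using hw
    subst this
    rw [op_zero, op_succ_of_le b 0 x 0 (by simp)]
  | succ n ih =>
    intro l v hv
    refine agree b _ _ (n + 1) (fun x w hw => ?_) l hv
    rcases low_cases x w with h | ⟨y, v, rfl, hyx, hv⟩
    · rw [op_succ_of_le b _ x w h, op_succ_of_le b _ x w h]
    · have hc : v.card ≤ n := by simpa using hw
      have hmem : op b n (b x) (e k v) - e k (x ::ₘ v) ∈ F k X n := F_mono hc (op_lead b n x v)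
      rw [op_succ_of_lt b _ x y v hyx hv, op_succ_of_lt b _ x y v hyx hv,
        ih _ _ (e_mem hc), ih _ _ (e_mem hc), ih _ _ hmem]

lemma op_stable {n m : ℕ} (h : m ≤ n) (l : L) {v : S k X} (hv : v ∈ F k X m) :
    op b n l v = op b m l v := by
  induction n, h using Nat.le_induction with
  | base => rfl
  | succ n hn ih => rw [op_stable_succ b n l v (F_mono hn hv), ih]

/-- The action. -/
noncomputable def act : L →ₗ[k] Module.End k (S k X) :=
  b.constr k (fun x => Finsupp.linearCombination k (fun w => op b w.card (b x) (e k w)))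

lemma act_eq_op {n : ℕ} (l : L) {v : S k X} (hv : v ∈ F k X n) : act b l v = op b n l v := by
  refine agree b _ _ n (fun x w hw => ?_) l hv
  rw [op_stable b hw (b x) (e_mem le_rfl)]
  simp [act]

lemma act_mem (l : L) {m : ℕ} {v : S k X} (hv : v ∈ F k X m) : act b l v ∈ F k X (m + 1) := by
  rw [act_eq_op b l hv]; exact op_mem b m l hv

lemma act_lead (x : X) (w : Multiset X) : act b (b x) (e k w) - e k (x ::ₘ w) ∈ F k X w.card := by
  rw [act_eq_op b (b x) (e_mem le_rfl)]; exact op_lead b _ x w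

lemma act_of_le (x : X) (w : Multiset X) (h : ∀ z ∈ w, x ≤ z) :
    act b (b x) (e k w) = e k (x ::ₘ w) := by
  rw [act_eq_op b (b x) (e_mem (Nat.le_succ _)), op_succ_of_le b _ x w h]

lemma act_of_lt (x y : X) (w : Multiset X) (hyx : y < x) (h : ∀ z ∈ w, y ≤ z) :
    act b (b x) (act b (b y) (e k w)) =
      act b (b y) (act b (b x) (e k w)) + act b ⁅b x, b y⁆ (e k w) := by
  have h1 : act b (b y) (e k (x ::ₘ w)) = e k (x ::ₘ y ::ₘ w) := by
    rw [act_of_le b y, Multiset.cons_swap]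
    simpa using ⟨hyx.le, h⟩
  have h2 : act b (b x) (e k w) = (act b (b x) (e k w) - e k (x ::ₘ w)) + e k (x ::ₘ w) := by simp
  rw [h2, map_add, h1, act_of_le b y w h,
    act_eq_op b (n := w.card + 1) (b x) (e_mem (by simp)), op_succ_of_lt b _ x y w hyx h,
    act_eq_op b (n := w.card) (b y) (act_lead b x w), act_eq_op b (n := w.card) _ (e_mem le_rfl),
    act_eq_op b (n := w.card) _ (e_mem le_rfl)]
  abel

/-- The commutation relation on a filtration step. -/
def Comm (m : ℕ) : Prop := ∀ (l l' : L) (v : S k X), v ∈ F k X m →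
  act b l (act b l' v) - act b l' (act b l v) = act b ⁅l, l'⁆ v

lemma comm_of_basis (m : ℕ) (h : ∀ x y w, w.card ≤ m → y < x →
    act b (b x) (act b (b y) (e k w)) - act b (b y) (act b (b x) (e k w)) =
      act b ⁅b x, b y⁆ (e k w)) : Comm b m := by
  have h' : ∀ x y w, w.card ≤ m →
    act b (b x) (act b (b y) (e k w)) - act b (b y) (act b (b x) (e k w)) =
      act b ⁅b x, b y⁆ (e k w) := by
    intro x y w hw
    rcases lt_trichotomy x y with hxy | rfl | hxy
    · have := h y x w hw hxy
      rw [← lie_skew, map_neg, LinearMap.neg_apply, ← this]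
      abel
    · simp
    · exact h x y w hw hxy
  intro l l' v hv
  refine eq_of_F (act b l * act b l' - act b l' * act b l) (act b ⁅l, l'⁆) m (fun w hw => ?_) hv
  have key : ∀ l l' : L, act b l (act b l' (e k w)) - act b l' (act b l (e k w))
      = act b ⁅l, l'⁆ (e k w) := by
    have k1 : ∀ (x : X) (l' : L), act b (b x) (act b l' (e k w)) - act b l' (act b (b x) (e k w))
      = act b ⁅b x, l'⁆ (e k w) := by
      intro x l'
      exact mem_of_basis b (LinearMap.eqLocus
        (act b (b x) ∘ₗ (act b).flip (e k w) - (act b).flip (act b (b x) (e k w)))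
        ((act b).flip (e k w) ∘ₗ (LieAlgebra.ad k L (b x)))) (fun y => h' x y w hw) l'
    intro l l'
    have := mem_of_basis b (LinearMap.eqLocus
        ((act b).flip (act b l' (e k w)) - act b l' ∘ₗ (act b).flip (e k w))
        (-((act b).flip (e k w) ∘ₗ (LieAlgebra.ad k L l'))))
        (fun y => by
          have := k1 y l'
          rw [← lie_skew, map_neg, LinearMap.neg_apply] at this
          exact this) l
    rw [← lie_skew, map_neg, LinearMap.neg_apply]
    exact this
  simpa using key l l'

lemma comm_all (m : ℕ) : Comm b m := by
  induction m with
  | zero =>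
    refine comm_of_basis b 0 (fun x y w hw hyx => ?_)
    have : w = 0 := by simpa using hw
    subst this
    rw [act_of_lt b x y 0 hyx (by simp)]; abel
  | succ m ih =>
    refine comm_of_basis b _ (fun x y w hw hyx => ?_)
    rcases low_cases y w with h | ⟨z, v, rfl, hzy, hv⟩
    · rw [act_of_lt b x y w hyx h]; abel
    · have hc : v.card ≤ m := by simpa using hw
      have hzx := hzy.trans hyx
      have hz : e k (z ::ₘ v) = act b (b z) (e k v) := (act_of_le b z v hv).symm
      -- commuting past `z` on `t · v`
      have key : ∀ s t : X, z < s → z < t → act b (b s) (act b (b z) (act b (b t) (e k v))) =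
          act b (b z) (act b (b s) (act b (b t) (e k v))) +
            act b ⁅b s, b z⁆ (act b (b t) (e k v)) := by
        intro s t hs ht
        have hd : act b (b t) (e k v) = (act b (b t) (e k v) - e k (t ::ₘ v)) + e k (t ::ₘ v) := by
          simp
        have hr := ih (b s) (b z) _ (F_mono hc (act_lead b t v))
        have hl := act_of_lt b s z (t ::ₘ v) hs (by simpa using ⟨ht.le, hv⟩)
        rw [sub_eq_iff_eq_add'] at hr
        rw [hd]
        simp only [map_add (act b (b s)), map_add (act b (b z)), map_add (act b ⁅b s, b z⁆)]
        rw [hr, hl]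
        abel
      have full : ∀ s t : X, z < s → z < t → act b (b s) (act b (b t) (e k (z ::ₘ v))) =
          act b (b z) (act b (b s) (act b (b t) (e k v))) +
            act b ⁅b s, b z⁆ (act b (b t) (e k v)) + act b ⁅b t, b z⁆ (act b (b s) (e k v))
            + act b ⁅b s, ⁅b t, b z⁆⁆ (e k v) := by
        intro s t hs ht
        have h1 := ih (b s) ⁅b t, b z⁆ _ (e_mem hc)
        rw [sub_eq_iff_eq_add'] at h1
        rw [hz, act_of_lt b t z v ht hv, map_add, key s t hs ht, h1]
        abel
      rw [full x y hzx hzy, full y x hzy hzx, hz]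
      have h1 := ih (b x) (b y) _ (e_mem hc)
      have h2 := ih ⁅b x, b y⁆ (b z) _ (e_mem hc)
      have hj : ⁅⁅b x, b y⁆, b z⁆ = ⁅b x, ⁅b y, b z⁆⁆ - ⁅b y, ⁅b x, b z⁆⁆ := lie_lie _ _ _
      rw [hj, map_sub, LinearMap.sub_apply, ← h1, map_sub, sub_eq_iff_eq_add] at h2
      rw [h2]
      abel

end PBWAux

attribute [local instance] LieRing.ofAssociativeRing

/-- Every Lie algebra over a field acts on a space with a vector on which the orbit map is
injective. -/
theorem exists_faithful (k : Type u) [Field k] (L : Type u) [LieRing L] [LieAlgebra k L] :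
    ∃ (X : Type u) (f : L →ₗ⁅k⁆ Module.End k (Multiset X →₀ k)),
      (∀ l, f l (Finsupp.single 0 1) = 0 → l = 0) ∧
      (∀ l, f l (Finsupp.single 0 1) 0 = 0) := by
  let b := Module.Basis.ofVectorSpace k L
  let X := Module.Basis.ofVectorSpaceIndex k L
  let _ : LinearOrder X := IsWellOrder.linearOrder WellOrderingRel
  have hv : ∀ l, PBWAux.act b l (Finsupp.single 0 1) =
      (b.repr l).mapDomain (fun x => ({x} : Multiset X)) := by
    intro l
    refine PBWAux.mem_of_basis b (LinearMap.eqLocus ((PBWAux.act b).flip (Finsupp.single 0 1))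
      (Finsupp.lmapDomain k k (fun x => ({x} : Multiset X)) ∘ₗ b.repr.toLinearMap)) (fun x => ?_) l
    have := PBWAux.act_of_le b x 0 (by simp)
    simpa [Finsupp.mapDomain_single] using this
  refine ⟨X, { PBWAux.act b with map_lie' := ?_ }, ?_, ?_⟩
  · intro x y
    ext1 v
    ext1
    obtain ⟨m, hm⟩ := PBWAux.exists_mem_F (k := k) (X := X) (Finsupp.single v 1)
    have := PBWAux.comm_all b m x y _ hm
    simpa [LieRing.of_associative_ring_bracket] using this.symm
  · intro l hl
    have h1 : (b.repr l).mapDomain (fun x => ({x} : Multiset X)) = 0 := (hv l).symm.trans hl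
    have h2 : b.repr l = 0 := Finsupp.mapDomain_injective (fun x y h => by simpa using h)
      (h1.trans Finsupp.mapDomain_zero.symm)
    simpa using h2
  · intro l
    have : PBWAux.act b l (Finsupp.single 0 1) 0 = 0 := by
      rw [hv l]
      exact Finsupp.mapDomain_of_notMem_range _ _ (by rintro ⟨x, hx⟩; simp at hx)
    exact this

namespace ExtDerAux

open UniversalEnvelopingAlgebra

section SemiDirect

variable {k : Type u} [Field k] {L : Type u} [LieRing L] [LieAlgebra k L]
  {V : Type u} [AddCommGroup V] [Module k V]

/-- The semidirect product of `L` with a representation. -/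
def SD (_ρ : L →ₗ⁅k⁆ Module.End k V) : Type u := L × V

variable (ρ : L →ₗ⁅k⁆ Module.End k V)

/-- Pairs. -/
def SD.mk (x : L) (v : V) : SD ρ := (x, v)

instance : AddCommGroup (SD ρ) := inferInstanceAs (AddCommGroup (L × V))

instance : Module k (SD ρ) := inferInstanceAs (Module k (L × V))

instance : Bracket (SD ρ) (SD ρ) where
  bracket p q := (⁅p.1, q.1⁆, ρ p.1 q.2 - ρ q.1 p.2)

lemma SD.ext' {p q : SD ρ} (h1 : p.1 = q.1) (h2 : p.2 = q.2) : p = q := Prod.ext h1 h2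

@[simp] lemma SD.mk_fst (x : L) (v : V) : (SD.mk ρ x v).1 = x := rfl
@[simp] lemma SD.mk_snd (x : L) (v : V) : (SD.mk ρ x v).2 = v := rfl
@[simp] lemma SD.lie_fst (p q : SD ρ) : (⁅p, q⁆ : SD ρ).1 = ⁅p.1, q.1⁆ := rfl
@[simp] lemma SD.lie_snd (p q : SD ρ) : (⁅p, q⁆ : SD ρ).2 = ρ p.1 q.2 - ρ q.1 p.2 := rfl
@[simp] lemma SD.add_fst (p q : SD ρ) : (p + q).1 = p.1 + q.1 := rfl
@[simp] lemma SD.add_snd (p q : SD ρ) : (p + q).2 = p.2 + q.2 := rfl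
@[simp] lemma SD.smul_fst (c : k) (p : SD ρ) : (c • p).1 = c • p.1 := rfl
@[simp] lemma SD.smul_snd (c : k) (p : SD ρ) : (c • p).2 = c • p.2 := rfl
@[simp] lemma SD.zero_fst : (0 : SD ρ).1 = 0 := rfl
@[simp] lemma SD.zero_snd : (0 : SD ρ).2 = 0 := rfl

instance : LieRing (SD ρ) where
  add_lie p q r := by
    apply SD.ext' <;> simp
    abel
  lie_add p q r := by
    apply SD.ext' <;> simp
    abel
  lie_self p := by apply SD.ext' <;> simp
  leibniz_lie p q r := by
    apply SD.ext'
    · simp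
    · simp [LieRing.of_associative_ring_bracket]
      abel

instance : LieAlgebra k (SD ρ) where
  lie_smul c p q := by
    apply SD.ext' <;> simp [smul_sub]

/-- Inclusion of `L`. -/
def SD.inl : L →ₗ⁅k⁆ SD ρ where
  toFun x := SD.mk ρ x 0
  map_add' x y := by apply SD.ext' <;> simp
  map_smul' c x := by apply SD.ext' <;> simp
  map_lie' {x y} := by apply SD.ext' <;> simp

/-- Projection to `L`. -/
def SD.proj : SD ρ →ₗ⁅k⁆ L where
  toFun p := p.1
  map_add' _ _ := rfl
  map_smul' _ _ := rfl
  map_lie' := rfl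

/-- Functoriality. -/
def SD.map {L' : Type u} [LieRing L'] [LieAlgebra k L'] {W : Type u} [AddCommGroup W] [Module k W]
    (σ : L' →ₗ⁅k⁆ Module.End k W) (f : L →ₗ⁅k⁆ L') (g : V →ₗ[k] W)
    (h : ∀ x v, g (ρ x v) = σ (f x) (g v)) : SD ρ →ₗ⁅k⁆ SD σ where
  toFun p := SD.mk σ (f p.1) (g p.2)
  map_add' x y := by apply SD.ext' <;> simp
  map_smul' c x := by apply SD.ext' <;> simp
  map_lie' {x y} := by apply SD.ext' <;> simp [h]

end SemiDirect

section UEA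

variable {k : Type u} [Field k] {L : Type u} [LieRing L] [LieAlgebra k L]

lemma uea_induction {C : UniversalEnvelopingAlgebra k L → Prop}
    (h1 : ∀ c : k, C (algebraMap k _ c)) (h2 : ∀ x : L, C (ι k x))
    (h3 : ∀ a b, C a → C b → C (a * b)) (h4 : ∀ a b, C a → C b → C (a + b))
    (u : UniversalEnvelopingAlgebra k L) : C u := by
  have hs : Function.Surjective (mkAlgHom k L) := fun y => Quotient.inductionOn' y fun a => ⟨a, rfl⟩
  obtain ⟨t, rfl⟩ := hs u
  induction t using TensorAlgebra.induction with
  | algebraMap c => rw [AlgHom.commutes]; exact h1 c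
  | ι x => exact h2 x
  | mul a b ha hb => rw [map_mul]; exact h3 _ _ ha hb
  | add a b ha hb => rw [map_add]; exact h4 _ _ ha hb

lemma equivariant {V W : Type*} [AddCommGroup V] [Module k V] [AddCommGroup W] [Module k W]
    (Φ : UniversalEnvelopingAlgebra k L →ₐ[k] Module.End k V)
    (Ψ : UniversalEnvelopingAlgebra k L →ₐ[k] Module.End k W) (g : V →ₗ[k] W)
    (h : ∀ x v, g (Φ (ι k x) v) = Ψ (ι k x) (g v)) (u : UniversalEnvelopingAlgebra k L) :
    ∀ v, g (Φ u v) = Ψ u (g v) := by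
  induction u using uea_induction with
  | h1 c => intro v; simp [Module.algebraMap_end_apply]
  | h2 x => exact h x
  | h3 a b ha hb => intro v; rw [map_mul, map_mul, Module.End.mul_apply, Module.End.mul_apply, ha, hb]
  | h4 a b ha hb => intro v; rw [map_add, map_add, LinearMap.add_apply, LinearMap.add_apply, map_add, ha, hb]

/-- The span of powers of elements of `L`. -/
def Pw (k L : Type u) [Field k] [LieRing L] [LieAlgebra k L] :
    Submodule k (UniversalEnvelopingAlgebra k L) :=
  ⨆ n : ℕ, Submodule.span k (Set.range fun x : L => ι k x ^ n)

lemma pow_mem_Pw (x : L) (n : ℕ) : ι k x ^ n ∈ Pw k L :=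
  Submodule.mem_iSup_of_mem n (Submodule.subset_span ⟨x, rfl⟩)

lemma coeff_mem [Infinite k] {A : Type*} [AddCommGroup A] [Module k A] (W : Submodule k A) (N : ℕ)
    (c : ℕ → A) (h : ∀ t : k, ∑ i ∈ Finset.range N, t ^ i • c i ∈ W) (i : ℕ) (hi : i < N) :
    c i ∈ W := by
  by_contra hc
  obtain ⟨φ, hφ, hφW⟩ := Submodule.exists_le_ker_of_notMem hc
  let p : Polynomial k := ∑ i ∈ Finset.range N, Polynomial.monomial i (φ (c i))
  have hp : p = 0 := by
    apply Polynomial.funext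
    intro t
    have : φ (∑ i ∈ Finset.range N, t ^ i • c i) = 0 := hφW (h t)
    simpa [p, Polynomial.eval_finsetSum, mul_comm] using this
  have := congrArg (fun q => Polynomial.coeff q i) hp
  simp [p, Polynomial.coeff_monomial, hi] at this
  exact hφ this

lemma pow_expand {A : Type*} [Ring A] [Algebra k A] (x y : A) (n : ℕ) :
    ∃ c : ℕ → A, (∀ t : k, (x + t • y) ^ n = ∑ i ∈ Finset.range (n + 1), t ^ i • c i) ∧
      c 0 = x ^ n ∧ c 1 = ∑ i ∈ Finset.range n, x ^ i * y * x ^ (n - 1 - i) ∧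
      ∀ i, n < i → c i = 0 := by
  induction n with
  | zero => exact ⟨fun i => if i = 0 then 1 else 0, by simp, by simp, by simp, fun i hi => by simp [hi.ne']⟩
  | succ n ih =>
    obtain ⟨c, h, h0, h1, hn⟩ := ih
    refine ⟨fun i => x * c i + (if i = 0 then 0 else y * c (i - 1)), ?_, ?_, ?_, ?_⟩
    · intro t
      have h2 : ∑ i ∈ Finset.range (n + 1 + 1), t ^ i • (x * c i) =
          x * ∑ i ∈ Finset.range (n + 1), t ^ i • c i := by
        rw [Finset.sum_range_succ, hn _ (Nat.lt_succ_self n), Finset.mul_sum]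
        simp
      have h3 : ∑ i ∈ Finset.range (n + 1 + 1), t ^ i • (if i = 0 then 0 else y * c (i - 1)) =
          (t • y) * ∑ i ∈ Finset.range (n + 1), t ^ i • c i := by
        rw [Finset.sum_range_succ', Finset.mul_sum]
        simp [pow_succ, mul_smul]
      simp only [smul_add, Finset.sum_add_distrib]
      rw [h2, h3, ← h t, pow_succ', add_mul]
    · simp [h0, pow_succ']
    · simp only [one_ne_zero, if_false, h1, Nat.sub_self, h0]
      rw [Finset.sum_range_succ', Finset.mul_sum]
      simp only [pow_zero, one_mul, Nat.add_sub_cancel, Nat.sub_zero]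
      congr 1
      refine Finset.sum_congr rfl fun i hi => ?_
      rw [pow_succ', show n - (i + 1) = n - 1 - i by omega]
      simp only [mul_assoc]
    · intro i hi
      simp [hn i (by omega), hn (i - 1) (by omega)]

lemma sandwich_mem [CharZero k] (n : ℕ) : ∀ (x y : L) (i j : ℕ), i + j = n →
    ι k x ^ i * ι k y * ι k x ^ j ∈ Pw k L := by
  have base : ∀ n : ℕ, (∀ (x y : L) (i : ℕ), i < n →
      ι k x ^ (i + 1) * ι k y * ι k x ^ (n - 1 - i) - ι k x ^ i * ι k y * ι k x ^ (n - i)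
        ∈ Pw k L) → ∀ (x y : L) (i j : ℕ), i + j = n →
      ι k x ^ i * ι k y * ι k x ^ j ∈ Pw k L := by
    intro n hn x y i j hij
    have hdiff : ∀ i, i ≤ n →
        ι k x ^ i * ι k y * ι k x ^ (n - i) - ι k y * ι k x ^ n ∈ Pw k L := by
      intro i
      induction i with
      | zero => intro _; simp
      | succ i ih =>
        intro hi
        have h1 := add_mem (hn x y i hi) (ih (by omega))
        rw [sub_add_sub_cancel] at h1
        rwa [show n - (i + 1) = n - 1 - i by omega]
    obtain ⟨c, hc, -, hc1, -⟩ := pow_expand (k := k) (ι k x) (ι k y) (n + 1)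
    have hsum : c 1 ∈ Pw k L := by
      refine coeff_mem (Pw k L) (n + 1 + 1) c (fun t => ?_) 1 (by omega)
      rw [← hc t, ← map_smul, ← map_add]
      exact pow_mem_Pw _ _
    rw [hc1, Nat.add_sub_cancel] at hsum
    have h2 : ∑ i ∈ Finset.range (n + 1),
        (ι k x ^ i * ι k y * ι k x ^ (n - i) - ι k y * ι k x ^ n) ∈ Pw k L :=
      Submodule.sum_mem _ fun i hi => hdiff i (by simp at hi; omega)
    rw [Finset.sum_sub_distrib, Finset.sum_const, Finset.card_range] at h2
    have h3 := sub_mem hsum h2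
    rw [sub_sub_cancel, ← Nat.cast_smul_eq_nsmul k] at h3
    have h4 : ι k y * ι k x ^ n ∈ Pw k L :=
      (Submodule.smul_mem_iff _ (by exact_mod_cast Nat.succ_ne_zero n)).1 h3
    have h5 := add_mem (hdiff i (by omega)) h4
    rw [sub_add_cancel] at h5
    rwa [show n - i = j by omega] at h5
  induction n with
  | zero => exact base 0 (by simp)
  | succ n ih =>
    refine base (n + 1) (fun x y i hi => ?_)
    have h1 := ih x ⁅x, y⁆ i (n - i) (by omega)
    rw [LieHom.map_lie, LieRing.of_associative_ring_bracket] at h1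
    have h2 : n + 1 - i = (n - i) + 1 := by omega
    rw [Nat.add_sub_cancel, h2, pow_succ, pow_succ' _ (n - i)]
    simpa only [mul_sub, sub_mul, mul_assoc] using h1

lemma Pw_top [CharZero k] (u : UniversalEnvelopingAlgebra k L) : u ∈ Pw k L := by
  have hl : ∀ (y : L) (v : UniversalEnvelopingAlgebra k L), v ∈ Pw k L → ι k y * v ∈ Pw k L := by
    intro y v hv
    have : Pw k L ≤ (Pw k L).comap (LinearMap.mulLeft k (ι k y)) := by
      refine iSup_le fun n => Submodule.span_le.2 ?_
      rintro _ ⟨x, rfl⟩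
      have := sandwich_mem (k := k) n x y 0 n (by simp)
      simpa using this
    exact this hv
  have : ∀ v, v ∈ Pw k L → u * v ∈ Pw k L := by
    induction u using uea_induction with
    | h1 c => intro v hv; rw [← Algebra.smul_def]; exact Submodule.smul_mem _ _ hv
    | h2 x => exact hl x
    | h3 a b ha hb => intro v hv; rw [mul_assoc]; exact ha _ (hb _ hv)
    | h4 a b ha hb => intro v hv; rw [add_mul]; exact add_mem (ha _ hv) (hb _ hv)
  have h1 := this 1 (by simpa using pow_mem_Pw (k := k) (0 : L) 0)
  simpa using h1

open TensorProduct in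
/-- The comultiplication. -/
noncomputable def Delta (k L : Type u) [Field k] [LieRing L] [LieAlgebra k L] :
    UniversalEnvelopingAlgebra k L →ₐ[k]
      UniversalEnvelopingAlgebra k L ⊗[k] UniversalEnvelopingAlgebra k L :=
  lift k
    { toFun := fun x => ι k x ⊗ₜ 1 + 1 ⊗ₜ ι k x
      map_add' := fun x y => by
        rw [map_add, TensorProduct.add_tmul, TensorProduct.tmul_add]; abel
      map_smul' := fun c x => by
        rw [map_smul, TensorProduct.tmul_smul, ← TensorProduct.smul_tmul', smul_add]; rfl
      map_lie' := fun {x y} => by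
        simp only [LieHom.map_lie, LieRing.of_associative_ring_bracket, mul_add, add_mul,
          Algebra.TensorProduct.tmul_mul_tmul, mul_one, one_mul, TensorProduct.sub_tmul,
          TensorProduct.tmul_sub]
        abel }

open TensorProduct in
lemma Delta_ι (x : L) : Delta k L (ι k x) = ι k x ⊗ₜ 1 + 1 ⊗ₜ ι k x :=
  lift_ι_apply k _ x

/-- The Adams operation. -/
noncomputable def Psi (k L : Type u) [Field k] [LieRing L] [LieAlgebra k L] :
    Module.End k (UniversalEnvelopingAlgebra k L) :=
  LinearMap.mul' k _ ∘ₗ (Delta k L).toLinearMap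

lemma Psi_pow (x : L) (n : ℕ) : Psi k L (ι k x ^ n) = (2 : k) ^ n • ι k x ^ n := by
  have hc : Commute (ι k x ⊗ₜ[k] (1 : UniversalEnvelopingAlgebra k L))
      ((1 : UniversalEnvelopingAlgebra k L) ⊗ₜ[k] ι k x) := by
    simp [Commute, SemiconjBy]
  have h1 : Psi k L (ι k x ^ n) = LinearMap.mul' k _ (Delta k L (ι k x ^ n)) := rfl
  rw [h1, map_pow, Delta_ι, hc.add_pow, map_sum]
  have h2 : ∀ i ∈ Finset.range (n + 1), LinearMap.mul' k (UniversalEnvelopingAlgebra k L)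
      ((ι k x ⊗ₜ[k] 1) ^ i * (1 ⊗ₜ[k] ι k x) ^ (n - i) * ((n.choose i : ℕ) :
        TensorProduct k (UniversalEnvelopingAlgebra k L) (UniversalEnvelopingAlgebra k L))) =
      (n.choose i : k) • ι k x ^ n := by
    intro i hi
    have hi' : i ≤ n := by simp at hi; omega
    rw [← nsmul_eq_mul', map_nsmul, Nat.cast_smul_eq_nsmul k]
    simp only [Algebra.TensorProduct.tmul_pow, one_pow, Algebra.TensorProduct.tmul_mul_tmul,
      one_mul, mul_one, LinearMap.mul'_apply]
    rw [← pow_add, Nat.add_sub_cancel' hi']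
  rw [Finset.sum_congr rfl h2, ← Finset.sum_smul, ← Nat.cast_sum, Nat.sum_range_choose]
  simp

open TensorProduct in
lemma primitive_mem [CharZero k] (u : UniversalEnvelopingAlgebra k L)
    (hu : Delta k L u = u ⊗ₜ 1 + 1 ⊗ₜ u) : ∃ a : L, ι k a = u := by
  have hP : Psi k L u = (2 : k) • u := by
    have h1 : Psi k L u = LinearMap.mul' k _ (Delta k L u) := rfl
    rw [h1, hu]
    simp [two_smul]
  have hmem := Pw_top u
  have hle : Pw k L ≤ Submodule.span k (Set.range fun x : L => ι k x ^ 1) ⊔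
      ⨆ (μ : k) (_ : μ ≠ 2), (Psi k L).eigenspace μ := by
    refine iSup_le fun n => ?_
    by_cases hn : n = 1
    · subst hn; exact le_sup_left
    · refine le_trans ?_ le_sup_right
      refine le_trans ?_ (le_iSup₂_of_le ((2 : k) ^ n) ?_ le_rfl)
      · refine Submodule.span_le.2 ?_
        rintro _ ⟨x, rfl⟩
        exact Module.End.mem_eigenspace_iff.2 (Psi_pow x n)
      · intro h
        have h' : (2 : ℕ) ^ n = 2 ^ 1 := by exact_mod_cast h.trans (pow_one 2).symm
        exact hn (Nat.pow_right_injective le_rfl h')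
  obtain ⟨w, hw, r, hr, hwr⟩ := Submodule.mem_sup.1 (hle hmem)
  have hw' : ∃ a : L, ι k a = w := by
    have : Submodule.span k (Set.range fun x : L => ι k x ^ 1) ≤
        LinearMap.range ((ι k : L →ₗ⁅k⁆ UniversalEnvelopingAlgebra k L) :
          L →ₗ[k] UniversalEnvelopingAlgebra k L) := by
      refine Submodule.span_le.2 ?_
      rintro _ ⟨x, rfl⟩
      exact ⟨x, (pow_one _).symm⟩
    exact this hw
  obtain ⟨a, rfl⟩ := hw'
  refine ⟨a, ?_⟩
  have hr2 : r ∈ (Psi k L).eigenspace 2 := by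
    rw [Module.End.mem_eigenspace_iff]
    have hr' : r = u - ι k a := by rw [← hwr]; abel
    have h1 := Psi_pow (k := k) a 1
    rw [pow_one, pow_one] at h1
    rw [hr', map_sub, hP, h1, smul_sub]
  have hd := (Module.End.eigenspaces_iSupIndep (Psi k L)) 2
  have : r = 0 := Submodule.disjoint_def.1 hd r hr2 hr
  rw [← hwr, this, add_zero]

end UEA
end ExtDerAux

namespace ExtDerAux

open UniversalEnvelopingAlgebra

section Main

variable {k : Type u} [Field k] {L : Type u} [LieRing L] [LieAlgebra k L]

/-- The left regular representation. -/
noncomputable def reg (k L : Type u) [Field k] [LieRing L] [LieAlgebra k L] :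
    L →ₗ⁅k⁆ Module.End k (UniversalEnvelopingAlgebra k L) :=
  (lift k).symm (Algebra.lmul k (UniversalEnvelopingAlgebra k L))

lemma reg_apply (x : L) (v : UniversalEnvelopingAlgebra k L) : reg k L x v = ι k x * v := rfl

lemma exists_u (D : LieExtendedDerivation k L) : ∃ u : UniversalEnvelopingAlgebra k L,
    ∀ (V : Type u) [AddCommGroup V] [Module k V] (ρ : L →ₗ⁅k⁆ Module.End k V) (v : V),
      D.d (SD ρ) (SD.inl ρ) (SD.mk ρ 0 v) = SD.mk ρ 0 (lift k ρ u v) := by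
  refine ⟨(D.d (SD (reg k L)) (SD.inl _) (SD.mk _ 0 1)).2, ?_⟩
  intro V _ _ ρ v
  apply SD.ext'
  · have h := D.naturality (SD ρ) L (SD.inl ρ) (SD.proj ρ) (SD.mk ρ 0 v)
    have h0 : SD.proj ρ (SD.mk ρ 0 v) = 0 := rfl
    rw [h0, map_zero] at h
    exact h
  · let g : SD (reg k L) →ₗ⁅k⁆ SD ρ := SD.map (reg k L) ρ LieHom.id
      ((lift k ρ).toLinearMap.flip v) (by
        intro x w
        simp [reg_apply, lift_ι_apply, -ι_apply])
    have h := D.naturality (SD (reg k L)) (SD ρ) (SD.inl _) g (SD.mk _ 0 1)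
    have hg : g.comp (SD.inl _) = SD.inl ρ := by
      ext x
      apply SD.ext' <;> simp [g, SD.map, SD.inl]
    have h1 : g (SD.mk _ 0 1) = SD.mk ρ 0 v := by
      apply SD.ext' <;> simp [g, SD.map]
    rw [hg, h1] at h
    rw [← h]
    rfl

/-- Coefficients 0 and 1 of a polynomial, as a Lie morphism. -/
noncomputable def coeffs (k A : Type u) [Field k] [Ring A] [Algebra k A] :
    Polynomial A →ₗ⁅k⁆ SD (LieAlgebra.ad k A) where
  toFun p := SD.mk _ (p.coeff 0) (p.coeff 1)
  map_add' p q := by apply SD.ext' <;> simp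
  map_smul' c p := by apply SD.ext' <;> simp
  map_lie' {p q} := by
    apply SD.ext' <;>
      simp [LieRing.of_associative_ring_bracket, Polynomial.mul_coeff_zero,
        Polynomial.mul_coeff_one]
    abel

/-- Scaling of the variable by 2. -/
noncomputable def scale (k A : Type u) [Field k] [Ring A] [Algebra k A] :
    Polynomial A →ₐ[k] Polynomial A :=
  Polynomial.eval₂AlgHom (Polynomial.CAlgHom) (2 * Polynomial.X) (by
    intro a
    exact (Commute.ofNat_right _ 2).mul_right (Polynomial.commute_X _).symm)

/-- Evaluation at 1. -/
noncomputable def eval1 (k A : Type u) [Field k] [Ring A] [Algebra k A] :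
    Polynomial A →ₐ[k] A :=
  Polynomial.eval₂AlgHom (AlgHom.id k A) 1 (fun _ => Commute.one_right _)

lemma scale_coeff (A : Type u) [Ring A] [Algebra k A] (p : Polynomial A) (n : ℕ) :
    (scale k A p).coeff n = (2 : k) ^ n • p.coeff n := by
  induction p using Polynomial.induction_on' with
  | add p q hp hq => simp [hp, hq]
  | monomial m a =>
    have h1 : scale k A (Polynomial.monomial m a) = Polynomial.monomial m ((2 : k) ^ m • a) := by
      have h2 : (2 * Polynomial.X : Polynomial A) ^ m = (2 : k) ^ m • Polynomial.X ^ m := by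
        have h3 : (2 * Polynomial.X : Polynomial A) = (2 : k) • Polynomial.X := by
          rw [two_smul, two_mul]
        rw [h3, smul_pow]
      change Polynomial.eval₂ _ (2 * Polynomial.X) (Polynomial.monomial m a) = _
      rw [Polynomial.eval₂_monomial, h2, mul_smul_comm, ← Polynomial.smul_monomial,
        ← Polynomial.C_mul_X_pow_eq_monomial]
      rfl
    rw [h1, Polynomial.coeff_monomial, Polynomial.coeff_monomial]
    split_ifs with h
    · rw [h]
    · simp

/-- `C` as a Lie morphism. -/
noncomputable def constL (k A : Type u) [Field k] [Ring A] [Algebra k A] :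
    A →ₗ⁅k⁆ Polynomial A := (Polynomial.CAlgHom : A →ₐ[k] Polynomial A)

lemma constL_apply (A : Type u) [Ring A] [Algebra k A] (a : A) :
    constL k A a = Polynomial.C a := rfl

lemma d_assoc [CharZero k] (D : LieExtendedDerivation k L) (u : UniversalEnvelopingAlgebra k L)
    (hu : ∀ (V : Type u) [AddCommGroup V] [Module k V] (ρ : L →ₗ⁅k⁆ Module.End k V) (v : V),
      D.d (SD ρ) (SD.inl ρ) (SD.mk ρ 0 v) = SD.mk ρ 0 (lift k ρ u v))
    (A : Type u) [Ring A] [Algebra k A] (f : L →ₗ⁅k⁆ A) (m : A) :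
    D.d A f m = lift k ((LieAlgebra.ad k A).comp f) u m := by
  set um := lift k ((LieAlgebra.ad k A).comp f) u m with hum
  let ρ := (LieAlgebra.ad k A).comp f
  let ρ' := LieAlgebra.ad k A
  let h : SD ρ →ₗ⁅k⁆ SD ρ' := SD.map ρ ρ' f LinearMap.id (fun x v => rfl)
  have e1 := D.naturality (SD ρ) (SD ρ') (SD.inl ρ) h (SD.mk ρ 0 m)
  rw [hu A ρ m] at e1
  have hh : ∀ a : A, h (SD.mk ρ 0 a) = SD.mk ρ' 0 a := by
    intro a
    apply SD.ext' <;> simp [h, SD.map]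
  rw [hh, hh] at e1
  let q : Polynomial A := D.d (Polynomial A) ((constL k A).comp f) (Polynomial.monomial 1 m)
  have e2 := D.naturality (Polynomial A) (SD ρ') ((constL k A).comp f) (coeffs k A)
    (Polynomial.monomial 1 m)
  have hcomp : (coeffs k A).comp ((constL k A).comp f) = h.comp (SD.inl ρ) := by
    ext x
    apply SD.ext' <;> simp [h, SD.map, SD.inl, coeffs, constL_apply]
  have hm : coeffs k A (Polynomial.monomial 1 m) = SD.mk ρ' 0 m := by
    apply SD.ext' <;> simp [coeffs, Polynomial.coeff_monomial]
  rw [hcomp, hm, ← e1] at e2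
  have hq1 : q.coeff 1 = um := congrArg Prod.snd e2
  have e3 := D.naturality (Polynomial A) (Polynomial A) ((constL k A).comp f)
    (scale k A : Polynomial A →ₗ⁅k⁆ Polynomial A) (Polynomial.monomial 1 m)
  have hs : (scale k A : Polynomial A →ₗ⁅k⁆ Polynomial A).comp ((constL k A).comp f) =
      (constL k A).comp f := by
    ext x
    simp [scale, constL_apply]
  have hsm : (scale k A : Polynomial A →ₗ⁅k⁆ Polynomial A) (Polynomial.monomial 1 m) =
      (2 : k) • Polynomial.monomial 1 m := by
    change scale k A (Polynomial.monomial 1 m) = _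
    ext n
    rw [scale_coeff, Polynomial.coeff_smul, Polynomial.coeff_monomial]
    split_ifs with hn
    · rw [← hn, pow_one]
    · simp
  rw [hs, hsm, map_smul] at e3
  have hq : q = Polynomial.monomial 1 um := by
    ext n
    rw [Polynomial.coeff_monomial]
    split_ifs with hn
    · rw [← hn, hq1]
    · have h1 : (scale k A q).coeff n = ((2 : k) • q).coeff n :=
        congrArg (fun p : Polynomial A => p.coeff n) e3
      rw [scale_coeff, Polynomial.coeff_smul, ← sub_eq_zero, ← sub_smul, smul_eq_zero] at h1
      rcases h1 with h1 | h1
      · exfalso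
        rw [sub_eq_zero] at h1
        have h' : (2 : ℕ) ^ n = 2 ^ 1 := by exact_mod_cast h1.trans (pow_one 2).symm
        exact hn (Nat.pow_right_injective le_rfl h').symm
      · exact h1
  have e4 := D.naturality (Polynomial A) A ((constL k A).comp f)
    (eval1 k A : Polynomial A →ₗ⁅k⁆ A) (Polynomial.monomial 1 m)
  have hs' : (eval1 k A : Polynomial A →ₗ⁅k⁆ A).comp ((constL k A).comp f) = f := by
    ext x
    simp [eval1, constL_apply]
  have hev : ∀ a : A, (eval1 k A : Polynomial A →ₗ⁅k⁆ A) (Polynomial.monomial 1 a) = a := by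
    intro a
    simp [eval1]
  rw [hs', hev] at e4
  rw [← e4]
  change (eval1 k A : Polynomial A →ₗ⁅k⁆ A) q = um
  rw [hq, hev]

lemma d_general [CharZero k] (D : LieExtendedDerivation k L) (u : UniversalEnvelopingAlgebra k L)
    (hu : ∀ (V : Type u) [AddCommGroup V] [Module k V] (ρ : L →ₗ⁅k⁆ Module.End k V) (v : V),
      D.d (SD ρ) (SD.inl ρ) (SD.mk ρ 0 v) = SD.mk ρ 0 (lift k ρ u v))
    (M : Type u) [LieRing M] [LieAlgebra k M] (f : L →ₗ⁅k⁆ M) (m : M) :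
    D.d M f m = lift k ((LieAlgebra.ad k M).comp f) u m := by
  obtain ⟨X, j, hj, -⟩ := exists_faithful k M
  have hinj : Function.Injective j := by
    refine (injective_iff_map_eq_zero j).2 fun a ha => hj a ?_
    rw [ha]; rfl
  apply hinj
  rw [D.naturality, d_assoc D u hu]
  refine (equivariant _ _ (j : M →ₗ[k] Module.End k (Multiset X →₀ k)) ?_ u m).symm
  intro x v
  rw [lift_ι_apply, lift_ι_apply]
  simp

open TensorProduct in
/-- The space used to detect primitivity. -/
abbrev P (k L : Type u) [Field k] [LieRing L] [LieAlgebra k L] : Type u :=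
  k × UniversalEnvelopingAlgebra k L ×
    (UniversalEnvelopingAlgebra k L ⊗[k] UniversalEnvelopingAlgebra k L)

/-- The representation on `P`. -/
noncomputable def repP (k L : Type u) [Field k] [LieRing L] [LieAlgebra k L] :
    L →ₗ⁅k⁆ Module.End k (P k L) where
  toFun x := LinearMap.prodMap 0
    (LinearMap.prodMap (LinearMap.mulLeft k (ι k x)) (LinearMap.mulLeft k (Delta k L (ι k x))))
  map_add' x y := by
    refine LinearMap.ext fun p => ?_
    simp [-ι_apply, add_mul]
  map_smul' c x := by
    refine LinearMap.ext fun p => ?_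
    simp [-ι_apply]
  map_lie' {x y} := by
    refine LinearMap.ext fun p => ?_
    simp [-ι_apply, LieRing.of_associative_ring_bracket, sub_mul, mul_assoc]

lemma repP_apply (x : L) (p : P k L) :
    repP k L x p = (0, ι k x * p.2.1, Delta k L (ι k x) * p.2.2) := rfl

/-- Maps `k → U`. -/
noncomputable def what (k L : Type u) [Field k] [LieRing L] [LieAlgebra k L] :
    UniversalEnvelopingAlgebra k L →ₗ[k] Module.End k (P k L) :=
  LinearMap.mk₂ k (fun w p => (0, p.1 • w, 0)) (by intros; simp)
    (by intro c w p; simp only [Prod.smul_mk, smul_zero, smul_comm p.1 c w])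
    (by intros; simp [add_smul]) (by intros; simp [mul_smul])

open TensorProduct in
/-- Maps `k → U ⊗ U`. -/
noncomputable def that (k L : Type u) [Field k] [LieRing L] [LieAlgebra k L] :
    (UniversalEnvelopingAlgebra k L ⊗[k] UniversalEnvelopingAlgebra k L)
      →ₗ[k] Module.End k (P k L) :=
  LinearMap.mk₂ k (fun w p => (0, 0, p.1 • w)) (by intros; simp)
    (by intro c w p; simp only [Prod.smul_mk, smul_zero, smul_comm p.1 c w])
    (by intros; simp [add_smul]) (by intros; simp [mul_smul])

open TensorProduct in
/-- Maps `U → U ⊗ U`. -/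
noncomputable def vhat (k L : Type u) [Field k] [LieRing L] [LieAlgebra k L] :
    UniversalEnvelopingAlgebra k L →ₗ[k] Module.End k (P k L) :=
  LinearMap.mk₂ k (fun w p => (0, 0, w ⊗ₜ p.2.1)) (by intros; simp [add_tmul])
    (by intros; simp [smul_tmul'])
    (by intros; simp [tmul_add]) (by intros; simp)

lemma what_apply (w : UniversalEnvelopingAlgebra k L) (p : P k L) :
    what k L w p = (0, p.1 • w, 0) := rfl
lemma that_apply (w) (p : P k L) : that k L w p = (0, 0, p.1 • w) := rfl
lemma vhat_apply (w : UniversalEnvelopingAlgebra k L) (p : P k L) :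
    vhat k L w p = (0, 0, w ⊗ₜ p.2.1) := rfl

open TensorProduct in
lemma bracket_hat (v w : UniversalEnvelopingAlgebra k L) :
    ⁅vhat k L v, what k L w⁆ = that k L (v ⊗ₜ w) := by
  refine LinearMap.ext fun p => ?_
  simp [LieRing.of_associative_ring_bracket, what_apply, that_apply, vhat_apply]

open TensorProduct in
lemma primitive_of (D : LieExtendedDerivation k L) (u : UniversalEnvelopingAlgebra k L)
    (hu : ∀ (M : Type u) [LieRing M] [LieAlgebra k M] (f : L →ₗ⁅k⁆ M) (m : M),
      D.d M f m = lift k ((LieAlgebra.ad k M).comp f) u m) :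
    Delta k L u = u ⊗ₜ 1 + 1 ⊗ₜ u := by
  have hw : ∀ w, D.d _ (repP k L) (what k L w) = what k L (u * w) := by
    intro w
    rw [hu]
    refine (equivariant (Algebra.lmul k _) _ (what k L) ?_ u w).symm
    intro x v
    rw [lift_ι_apply]
    refine LinearMap.ext fun p => ?_
    simp [-ι_apply, LieRing.of_associative_ring_bracket, what_apply, repP_apply]
  have hv : ∀ w, D.d _ (repP k L) (vhat k L w) = vhat k L (u * w) := by
    intro w
    rw [hu]
    refine (equivariant (Algebra.lmul k _) _ (vhat k L) ?_ u w).symm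
    intro x v
    rw [lift_ι_apply]
    refine LinearMap.ext fun p => ?_
    simp [-ι_apply, LieRing.of_associative_ring_bracket, vhat_apply, repP_apply, Delta_ι, add_mul]
  have ht : ∀ w, D.d _ (repP k L) (that k L w) = that k L (Delta k L u * w) := by
    intro w
    rw [hu]
    refine (equivariant ((Algebra.lmul k _).comp (Delta k L)) _ (that k L) ?_ u w).symm
    intro x v
    rw [lift_ι_apply]
    refine LinearMap.ext fun p => ?_
    simp [-ι_apply, LieRing.of_associative_ring_bracket, that_apply, repP_apply]
  have h := D.leibniz _ (repP k L) (vhat k L 1) (what k L 1)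
  rw [bracket_hat, ht, hw, hv, bracket_hat, bracket_hat, ← map_add] at h
  have h2 := congrArg (fun T : Module.End k (P k L) => (T (1, 0, 0)).2.2) h
  simpa [that_apply, ← Algebra.TensorProduct.one_def] using h2

end Main

end ExtDerAux

lemma comm_sub_aux {R : Type*} [Ring R] (x y t : R) (h : x * t - t * x = y * t - t * y) :
    (x - y) * t - t * (x - y) = 0 := by
  rw [sub_mul, mul_sub, ← sub_eq_zero.2 h]
  abel

lemma extDer_ext {k : Type u} [Field k] {L : Type u} [LieRing L] [LieAlgebra k L]
    (D E : LieExtendedDerivation k L)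
    (h : ∀ (M : Type u) [LieRing M] [LieAlgebra k M] (f : L →ₗ⁅k⁆ M) (m : M),
      D.d M f m = E.d M f m) : D = E := by
  cases D with
  | mk d1 _ _ =>
    cases E with
    | mk d2 _ _ =>
      have : @d1 = @d2 := by
        funext M _ _ f
        exact LinearMap.ext (h M f)
      subst this
      rfl

/-- The map `a ↦ (∂_{a,f})_f`, `∂_{a,f}(m) = [f a, m]`, is an injective
linear map from `L` into the space of extended derivations of `L`; if `k` has
characteristic zero, it is moreover a bijection onto the space of all extended
derivations of `L`. -/
theorem innerLieExtendedDerivation_injective_linear_and_bijective_of_charZero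
    (k : Type u) [Field k] (L : Type u) [LieRing L] [LieAlgebra k L] :
    Function.Injective (innerLieExtendedDerivation k L) ∧
    (∀ (c : k) (a b : L) (M : Type u) [LieRing M] [LieAlgebra k M] (f : L →ₗ⁅k⁆ M),
      (innerLieExtendedDerivation k L (c • a + b)).d M f =
        c • (innerLieExtendedDerivation k L a).d M f +
          (innerLieExtendedDerivation k L b).d M f) ∧
    (CharZero k → Function.Surjective (innerLieExtendedDerivation k L)) := by
  refine ⟨?_, ?_, ?_⟩
  · intro a b hab
    obtain ⟨X, f, hf, hf0⟩ := exists_faithful k L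
    classical
    let T : Module.End k (Multiset X →₀ k) :=
      Finsupp.linearCombination k fun w => if w = 0 then Finsupp.single 0 1 else 0
    have hT1 : T (Finsupp.single 0 1) = Finsupp.single 0 1 := by simp [T]
    have hT : ∀ v : Multiset X →₀ k, T v = Finsupp.single 0 (v 0) := by
      intro v
      induction v using Finsupp.induction_linear with
      | zero => simp
      | add p q hp hq => rw [map_add, hp, hq, Finsupp.add_apply, Finsupp.single_add]
      | single w c =>
        by_cases hw : w = 0
        · subst hw; simp [T]
        · simp [T, hw]
    have h1 : f a * T - T * f a = f b * T - T * f b :=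
      congrArg (fun D : LieExtendedDerivation k L => D.d _ f T) hab
    have h2 : f (a - b) * T - T * f (a - b) = 0 := by
      have hs : f (a - b) = f a - f b := map_sub f a b
      rw [hs]
      exact comm_sub_aux (R := Module.End k (Multiset X →₀ k)) (f a) (f b) T h1
    have h3 := congrArg (fun g : Module.End k (Multiset X →₀ k) => g (Finsupp.single 0 1)) h2
    simp only [LinearMap.sub_apply, Module.End.mul_apply, hT1, LinearMap.zero_apply] at h3
    rw [hT, hf0, Finsupp.single_zero, sub_zero] at h3
    exact sub_eq_zero.1 (hf _ h3)
  · intro c a b M _ _ f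
    refine LinearMap.ext fun m => ?_
    simp [innerLieExtendedDerivation]
  · intro _ D
    obtain ⟨u, hu⟩ := ExtDerAux.exists_u D
    have hg := fun (M : Type u) [LieRing M] [LieAlgebra k M] (f : L →ₗ⁅k⁆ M) (m : M) =>
      ExtDerAux.d_general D u hu M f m
    obtain ⟨a, rfl⟩ := ExtDerAux.primitive_mem u (ExtDerAux.primitive_of D u hg)
    refine ⟨a, ?_⟩
    apply extDer_ext
    intro M _ _ f m
    rw [hg, UniversalEnvelopingAlgebra.lift_ι_apply]
    rfl
end

section
/- Every continuous automorphism of the unitary group U(n) that fixes the determinant (i.e., det(φ(x)) = det(x) for all x ∈ U(n)) is inner, i.e., of the form x ↦ u x u* for some u ∈ U(n). -/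
theorem circle_char (χ : Circle →* Circle) (h : Continuous χ) : ∃ k : ℤ, ∀ z, χ z = z ^ k := by
  have : Fact (0 < 2 * Real.pi) := ⟨Real.two_pi_pos⟩
  let f : C(AddCircle (2 * Real.pi), ℂ) :=
    ⟨fun x => (χ (AddCircle.toCircle x) : ℂ), by
      have := AddCircle.continuous_toCircle (T := 2 * Real.pi)
      fun_prop⟩
  have hf : ∀ x y, f (x + y) = f x * f y := by
    intro x y; simp [f, AddCircle.toCircle_add]
  have hf0 : f 0 = 1 := by simp [f]
  have hex : ∃ k : ℤ, fourierCoeff f k ≠ 0 := by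
    by_contra! hk
    have hk' : fourierCoeff f = 0 := funext hk
    have := has_pointwise_sum_fourier_series_of_summable (f := f)
      (by rw [hk']; exact summable_zero) 0
    simp only [hk, zero_smul] at this
    have := this.unique hasSum_zero
    rw [hf0] at this
    exact one_ne_zero this
  obtain ⟨k, hk⟩ := hex
  refine ⟨k, fun z => ?_⟩
  obtain ⟨x, rfl⟩ : ∃ x : AddCircle (2 * Real.pi), AddCircle.toCircle x = z :=
    ⟨(AddCircle.homeomorphCircle Real.two_pi_pos.ne').symm z, by
      rw [← AddCircle.homeomorphCircle_apply Real.two_pi_pos.ne']; simp⟩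
  have h1 : fourierCoeff f k = fourier (-k) x * f x * fourierCoeff f k := by
    conv_lhs => rw [fourierCoeff, ← MeasureTheory.integral_add_right_eq_self _ x]
    rw [fourierCoeff, ← MeasureTheory.integral_const_mul]
    congr 1
    ext t
    rw [hf]
    simp only [smul_eq_mul, fourier_apply, smul_add, AddCircle.toCircle_add, Circle.coe_mul]
    ring
  have h2 : fourier (-k) x * f x = 1 := by
    apply mul_right_cancel₀ hk
    rw [← h1, one_mul]
  have h3 : AddCircle.toCircle (-(k • x)) * χ (AddCircle.toCircle x) = 1 := by
    ext
    rw [← neg_smul]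
    simpa [fourier_apply, f] using h2
  rw [AddCircle.toCircle_neg, inv_mul_eq_one] at h3
  rw [← h3, AddCircle.toCircle_zsmul]

theorem comb_lemma {ι α : Type*} [Fintype ι] [DecidableEq ι] [DecidableEq α] (f : ι → α)
    (p0 : ι)
    (H : ∀ π π' : Equiv.Perm ι, f ∘ π ≠ f → f ∘ π' ≠ f →
      (Finset.univ.filter fun i => f i ≠ f (π i)).card =
      (Finset.univ.filter fun i => f i ≠ f (π' i)).card) :
    ∃ p, ∀ j k, j ≠ p → k ≠ p → f j = f k := by
  by_cases hc : ∀ p q, f p = f q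
  · exact ⟨p0, fun j k _ _ => hc j k⟩
  push Not at hc
  obtain ⟨p, q, hpq⟩ := hc
  have hpq' : p ≠ q := fun h => hpq (by rw [h])
  have h2 : (Finset.univ.filter fun i => f i ≠ f (Equiv.swap p q i)).card ≤ 2 := by
    have : (Finset.univ.filter fun i => f i ≠ f (Equiv.swap p q i)) ⊆ {p, q} := by
      intro i hi
      simp only [Finset.mem_filter, Finset.mem_univ, true_and] at hi
      by_contra h
      simp only [Finset.mem_insert, Finset.mem_singleton, not_or] at h
      rw [Equiv.swap_apply_of_ne_of_ne h.1 h.2] at hi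
      exact hi rfl
    exact (Finset.card_le_card this).trans Finset.card_le_two
  have hsw : f ∘ Equiv.swap p q ≠ f := by
    intro h
    have := congrFun h p
    simp at this
    exact hpq this.symm
  have key : ∀ (π : Equiv.Perm ι) (a b c : ι), a ≠ b → a ≠ c → b ≠ c →
      f a ≠ f (π a) → f b ≠ f (π b) → f c ≠ f (π c) → False := by
    intro π a b c hab hac hbc ha hb hc
    have hπ : f ∘ π ≠ f := fun h => ha (congrFun h a).symm
    have hle := H π _ hπ hsw
    have : ({a, b, c} : Finset ι) ⊆ Finset.univ.filter fun i => f i ≠ f (π i) := by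
      intro i hi
      simp only [Finset.mem_insert, Finset.mem_singleton] at hi
      rcases hi with rfl | rfl | rfl <;> simp [*]
    have := Finset.card_le_card this
    rw [Finset.card_eq_three.2 ⟨a, b, c, hab, hac, hbc, rfl⟩] at this
    omega
  -- no two disjoint pairs
  have pairs : ∀ a b c d, a ≠ c → a ≠ d → b ≠ c → b ≠ d → f a ≠ f b → f c ≠ f d → False := by
    intro a b c d hac had hbc hbd hab hcd
    have hab' : a ≠ b := fun h => hab (by rw [h])
    have hcd' : c ≠ d := fun h => hcd (by rw [h])
    refine key (Equiv.swap a b * Equiv.swap c d) a b c hab' hac hbc ?_ ?_ ?_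
    · simp [Equiv.swap_apply_of_ne_of_ne hac had, hab]
    · simp [Equiv.swap_apply_of_ne_of_ne hbc hbd, hab.symm]
    · simp [Equiv.swap_apply_of_ne_of_ne had.symm hbd.symm, hcd]
  have tri : ∀ a b c, f a ≠ f b → f b ≠ f c → f c ≠ f a → False := by
    intro a b c hab hbc hca
    have hab' : a ≠ b := fun h => hab (by rw [h])
    have hbc' : b ≠ c := fun h => hbc (by rw [h])
    have hca' : c ≠ a := fun h => hca (by rw [h])
    refine key (Equiv.swap a b * Equiv.swap b c) a b c hab' hca'.symm hbc' ?_ ?_ ?_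
    · simp [Equiv.swap_apply_of_ne_of_ne hab' hca'.symm, hab]
    · simp [Equiv.swap_apply_of_ne_of_ne hca' hbc'.symm, hbc]
    · simp [hca]
  by_cases hq : ∀ r, r ≠ p → f r = f q
  · exact ⟨p, fun j k hj hk => (hq j hj).trans (hq k hk).symm⟩
  push Not at hq
  obtain ⟨r, hrp, hrq⟩ := hq
  refine ⟨q, ?_⟩
  have hr : f r = f p := by
    by_contra h
    exact tri p q r hpq hrq.symm h
  have : ∀ s, s ≠ q → f s = f p := by
    intro s hs
    by_contra hsp
    have hsp' : s ≠ p := fun h => hsp (by rw [h])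
    have hsr : s ≠ r := fun h => hsp (by rw [h, hr])
    have hqr : q ≠ r := fun h => hrq (by rw [h])
    exact pairs s p q r hs hsr hpq' hrp.symm hsp hrq.symm
  intro j k hj hk
  rw [this j hj, this k hk]

theorem mulSingle_comp_perm {ι : Type*} [DecidableEq ι] (i : ι) (z : Circle)
    (σ : Equiv.Perm ι) :
    (Pi.mulSingle i z : ι → Circle) ∘ σ = Pi.mulSingle (σ⁻¹ i) z := by
  ext j
  simp only [Function.comp, Pi.mulSingle_apply, Equiv.Perm.eq_inv_iff_eq]

theorem circle_neg_one_ne : (-1 : Circle) ≠ 1 := by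
  intro h
  have := congrArg (fun z : Circle => (z : ℂ)) h
  norm_num at this

theorem torus_lemma (n : ℕ) (hn : 2 ≤ n) (F : (Fin n → Circle) →* (Fin n → Circle))
    (hinj : Function.Injective F) (hF : Continuous F)
    (W1 : ∀ σ : Equiv.Perm (Fin n), ∃ π : Equiv.Perm (Fin n), ∀ d, F (d ∘ σ) = F d ∘ π)
    (W2 : ∀ π : Equiv.Perm (Fin n), ∃ σ : Equiv.Perm (Fin n), ∀ d, F (d ∘ σ) = F d ∘ π)
    (hdet : ∀ d, ∏ i, F d i = ∏ i, d i) (d : Fin n → Circle) :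
    ∑ i, (F d i : ℂ) = ∑ i, (d i : ℂ) := by
  classical
  have hne : ∀ p : Fin n, ∃ q, q ≠ p := by
    intro p
    have : Nontrivial (Fin n) := Fin.nontrivial_iff_two_le.2 hn
    exact exists_ne p
  let i0 : Fin n := ⟨0, by omega⟩
  have hsing : ∀ (i j : Fin n) (w : Circle), w ≠ 1 →
      (Pi.mulSingle i w : Fin n → Circle) = Pi.mulSingle j w → i = j := by
    intro i j w hw h
    by_contra hij
    have := congrFun h i
    rw [Pi.mulSingle_eq_same, Pi.mulSingle_eq_of_ne hij] at this
    exact hw this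
  -- the special position
  obtain ⟨p, hp⟩ : ∃ p, ∀ j k, j ≠ p → k ≠ p →
      F (Pi.mulSingle i0 (-1)) j = F (Pi.mulSingle i0 (-1)) k := by
    apply comb_lemma _ i0
    have hpi : ∀ π : Equiv.Perm (Fin n), F (Pi.mulSingle i0 (-1)) ∘ π ≠ F (Pi.mulSingle i0 (-1)) →
        ∃ j, j ≠ i0 ∧ F (Pi.mulSingle i0 (-1)) ∘ π = F (Pi.mulSingle j (-1)) := by
      intro π hπ
      obtain ⟨σ, hσ⟩ := W2 π
      refine ⟨σ⁻¹ i0, ?_, ?_⟩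
      · intro h
        apply hπ
        rw [← hσ, mulSingle_comp_perm, h]
      · rw [← hσ, mulSingle_comp_perm]
    intro π π' hπ hπ'
    obtain ⟨j, hj, ej⟩ := hpi π hπ
    obtain ⟨k, hk, ek⟩ := hpi π' hπ'
    obtain ⟨τ, hτ⟩ := W1 (Equiv.swap j k)
    have e1 : F (Pi.mulSingle i0 (-1)) ∘ τ = F (Pi.mulSingle i0 (-1)) := by
      rw [← hτ, mulSingle_comp_perm, Equiv.swap_inv,
        Equiv.swap_apply_of_ne_of_ne hj.symm hk.symm]
    have e2 : F (Pi.mulSingle j (-1)) ∘ τ = F (Pi.mulSingle k (-1)) := by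
      rw [← hτ, mulSingle_comp_perm, Equiv.swap_inv, Equiv.swap_apply_left]
    symm
    apply Finset.card_bij (fun i _ => τ i)
    · intro i hi
      simp only [Finset.mem_filter, Finset.mem_univ, true_and] at hi ⊢
      have a1 := congrFun e1 i
      have a2 := congrFun e2 i
      have a3 := congrFun ej (τ i)
      have a4 := congrFun ek i
      simp only [Function.comp] at a1 a2 a3 a4
      rw [a1, a3, a2, ← a4]; exact hi
    · intro a _ b _ h; exact τ.injective h
    · intro b hb
      refine ⟨τ⁻¹ b, ?_, by simp⟩
      simp only [Finset.mem_filter, Finset.mem_univ, true_and] at hb ⊢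
      have a1 := congrFun e1 (τ⁻¹ b)
      have a2 := congrFun e2 (τ⁻¹ b)
      have a3 := congrFun ej b
      have a4 := congrFun ek (τ⁻¹ b)
      have a5 : τ (τ⁻¹ b) = b := by simp
      simp only [Function.comp] at a1 a2 a3 a4
      rw [a4, ← a2, ← a1, a5, ← a3]; exact hb
  have hp2 : ∀ w j k, j ≠ p → k ≠ p →
      F (Pi.mulSingle i0 w) j = F (Pi.mulSingle i0 w) k := by
    intro w j k hj hk
    obtain ⟨σ, hσ⟩ := W2 (Equiv.swap j k)
    have e1 : F (Pi.mulSingle i0 (-1)) ∘ Equiv.swap j k = F (Pi.mulSingle i0 (-1)) := by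
      ext i
      simp only [Function.comp]
      rcases eq_or_ne i j with rfl | hij
      · rw [Equiv.swap_apply_left, hp _ _ hj hk]
      rcases eq_or_ne i k with rfl | hik
      · rw [Equiv.swap_apply_right, hp _ _ hj hk]
      rw [Equiv.swap_apply_of_ne_of_ne hij hik]
    rw [← hσ, mulSingle_comp_perm] at e1
    have e2 := hsing _ _ _ circle_neg_one_ne (hinj e1)
    have e3 := hσ (Pi.mulSingle i0 w)
    rw [mulSingle_comp_perm, e2] at e3
    have := congrFun e3 j
    simpa using this
  obtain ⟨q, hq⟩ := hne p
  let fa : Circle →* Circle :=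
    (Pi.evalMonoidHom (fun _ : Fin n => Circle) p).comp (F.comp (MonoidHom.mulSingle (fun _ : Fin n => Circle) i0))
  let fb : Circle →* Circle :=
    (Pi.evalMonoidHom (fun _ : Fin n => Circle) q).comp (F.comp (MonoidHom.mulSingle (fun _ : Fin n => Circle) i0))
  have hms : Continuous fun w : Circle => (Pi.mulSingle i0 w : Fin n → Circle) :=
    continuous_pi fun j => by
      rcases eq_or_ne j i0 with rfl | h
      · simpa using! continuous_id
      · simpa [Pi.mulSingle_eq_of_ne h] using continuous_const
  obtain ⟨A, hA⟩ := circle_char fa ((continuous_apply p).comp (hF.comp hms))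
  obtain ⟨B, hB⟩ := circle_char fb ((continuous_apply q).comp (hF.comp hms))
  replace hA : ∀ w, F (Pi.mulSingle i0 w) p = w ^ A := hA
  replace hB : ∀ w, F (Pi.mulSingle i0 w) q = w ^ B := hB
  have h0 : ∀ w j, F (Pi.mulSingle i0 w) j = if j = p then w ^ A else w ^ B := by
    intro w j
    split_ifs with h
    · rw [h, hA]
    · rw [hp2 w j q h hq, hB]
  choose W hW using fun i => W1 (Equiv.swap i0 i)
  let P : Fin n → Fin n := fun i => (W i)⁻¹ p
  have hi : ∀ i w j, F (Pi.mulSingle i w) j = if j = P i then w ^ A else w ^ B := by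
    intro i w j
    have := hW i (Pi.mulSingle i0 w)
    rw [mulSingle_comp_perm, Equiv.swap_inv, Equiv.swap_apply_left] at this
    rw [this, Function.comp, h0]
    simp only [P, Equiv.Perm.eq_inv_iff_eq]
  have hPinj : Function.Injective P := by
    intro i j hij
    apply hsing i j (-1) circle_neg_one_ne
    apply hinj
    ext k
    rw [hi, hi, hij]
  -- injectivity
  have hAB : ∀ w : Circle, w ^ (A - B) = 1 → w = 1 := by
    intro w hw
    by_contra hw1
    have hab : w ^ A = w ^ B := by
      rw [zpow_sub] at hw
      exact mul_inv_eq_one.1 hw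
    obtain ⟨j, hj⟩ := hne i0
    apply hj
    apply hsing j i0 w hw1
    apply hinj
    ext k
    rw [hi, hi, hab]; simp
  have hexp : ∀ k : ℤ, (∀ w : Circle, w ^ k = 1 → w = 1) → k = 1 ∨ k = -1 := by
    intro k hk
    have hk0 : k ≠ 0 := by
      rintro rfl
      exact circle_neg_one_ne (hk (-1) (by simp))
    have h1 : Circle.exp (2 * Real.pi / k) = 1 := by
      apply hk
      rw [← Circle.exp_zsmul, zsmul_eq_mul, mul_div_cancel₀ _ (by exact_mod_cast hk0),
        Circle.exp_two_pi]
    rw [Circle.exp_eq_one] at h1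
    obtain ⟨m, hm⟩ := h1
    have hk0' : (k : ℝ) ≠ 0 := by exact_mod_cast hk0
    have : (m : ℝ) * k = 1 := by
      field_simp at hm
      linarith
    have : m * k = 1 := by exact_mod_cast this
    exact Int.isUnit_iff.1 (IsUnit.of_mul_eq_one m (by rw [mul_comm]; exact this))
  have hzpow : ∀ k : ℤ, (∀ w : Circle, w ^ k = 1) → k = 0 := by
    intro k hk
    by_contra hk0
    have h1 := hk (Circle.exp (Real.pi / k))
    rw [← Circle.exp_zsmul, zsmul_eq_mul, mul_div_cancel₀ _ (by exact_mod_cast hk0),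
        Circle.exp_eq_one] at h1
    obtain ⟨m, hm⟩ := h1
    have h2 : (m : ℝ) * 2 = 1 := by
      have h3 := Real.pi_pos
      have : Real.pi * ((m : ℝ) * 2 - 1) = 0 := by linarith
      rcases mul_eq_zero.1 this with h | h
      · exact absurd h h3.ne'
      · linarith
    have : m * 2 = 1 := by exact_mod_cast h2
    omega
  have hsum : A + (n - 1) * B = 1 := by
    have : A + (n - 1) * B - 1 = 0 := by
      apply hzpow
      intro w
      have h1 := hdet (Pi.mulSingle i0 w)
      simp only [h0] at h1
      rw [← Finset.mul_prod_erase _ _ (Finset.mem_univ p), if_pos rfl,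
        Finset.prod_congr rfl (g := fun _ => w ^ B)
          (fun x hx => if_neg (Finset.ne_of_mem_erase hx)),
        Finset.prod_const, Finset.card_erase_of_mem (Finset.mem_univ p), Finset.card_univ,
        Fintype.card_fin, Fintype.prod_pi_mulSingle'] at h1
      rw [zpow_sub, zpow_add, zpow_one, mul_comm ((n : ℤ) - 1) B, zpow_mul, mul_inv_eq_one]
      convert h1 using 2
      rw [← zpow_natCast]
      congr 1
      push_cast [show 1 ≤ n by omega]
      rfl
    omega
  have hFd : ∀ i, F d (P i) = (d i) ^ A * ∏ k ∈ Finset.univ.erase i, (d k) ^ B := by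
    intro i
    conv_lhs => rw [← Finset.univ_prod_mulSingle d, map_prod]
    rw [Finset.prod_apply, ← Finset.mul_prod_erase _ _ (Finset.mem_univ i), hi, if_pos rfl]
    congr 1
    apply Finset.prod_congr rfl
    intro k hk
    rw [hi, if_neg]
    intro h
    exact Finset.ne_of_mem_erase hk (hPinj h).symm
  have hPbij : Function.Bijective P := Finite.injective_iff_bijective.1 hPinj
  rw [← hPbij.sum_comp (fun j => (F d j : ℂ))]
  rcases hexp _ hAB with h | h
  · have hB0 : B = 0 := by
      have : (n : ℤ) * B = 0 := by linarith
      rcases mul_eq_zero.1 this with h | h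
      · omega
      · exact h
    have hA1 : A = 1 := by omega
    subst hB0 hA1
    simp [hFd]
  · have h2 : (n : ℤ) * B = 2 := by linarith
    have hdv : n ∣ 2 := by
      have : (n : ℤ) ∣ 2 := ⟨B, h2.symm⟩
      exact_mod_cast this
    have hn2 : n = 2 := le_antisymm (Nat.le_of_dvd (by norm_num) hdv) hn
    subst hn2
    have hB1 : B = 1 := by push_cast at h2; omega
    have hA0 : A = 0 := by omega
    subst hB1 hA0
    have e0 : (Finset.univ : Finset (Fin 2)).erase 0 = {1} := by decide
    have e1 : (Finset.univ : Finset (Fin 2)).erase 1 = {0} := by decide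
    simp [hFd, e0, e1, add_comm]

/-- the diagonal torus -/
noncomputable def tor (n : ℕ) : (Fin n → Circle) →* Matrix.unitaryGroup (Fin n) ℂ where
  toFun d := ⟨Matrix.diagonal fun i => (d i : ℂ), by
    rw [Matrix.mem_unitaryGroup_iff, Matrix.star_eq_conjTranspose, Matrix.diagonal_conjTranspose,
      Matrix.diagonal_mul_diagonal, ← Matrix.diagonal_one]
    congr 1
    ext i
    simp [Complex.mul_conj]⟩
  map_one' := by ext; simp
  map_mul' a b := by
    apply Subtype.ext
    simp [Matrix.diagonal_mul_diagonal]

theorem tor_coe {n : ℕ} (d : Fin n → Circle) :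
    (tor n d : Matrix (Fin n) (Fin n) ℂ) = Matrix.diagonal fun i => (d i : ℂ) := rfl

theorem tor_injective {n : ℕ} : Function.Injective (tor n) := by
  intro a b h
  have h1 := congrArg (fun x : Matrix.unitaryGroup (Fin n) ℂ => (x : Matrix (Fin n) (Fin n) ℂ)) h
  simp only [tor_coe] at h1
  have h2 := Matrix.diagonal_injective h1
  ext i
  exact congrFun h2 i

/-- permutation matrices -/
noncomputable def pm {n : ℕ} (σ : Equiv.Perm (Fin n)) : Matrix.unitaryGroup (Fin n) ℂ :=
  ⟨σ.permMatrix ℂ, by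
    rw [Matrix.mem_unitaryGroup_iff, Matrix.star_eq_conjTranspose, Matrix.conjTranspose_permMatrix,
      ← Matrix.permMatrix_mul]
    simp⟩

theorem pm_mul_tor {n : ℕ} (σ : Equiv.Perm (Fin n)) (d : Fin n → Circle) :
    pm σ * tor n d * (pm σ)⁻¹ = tor n (d ∘ σ) := by
  rw [mul_inv_eq_iff_eq_mul]
  apply Subtype.ext
  ext i j
  simp only [Submonoid.coe_mul, tor_coe, Matrix.mul_diagonal, Matrix.diagonal_mul, pm,
    Equiv.Perm.permMatrix, PEquiv.toMatrix_apply, Function.comp]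
  by_cases h : σ i = j <;> simp [h]

theorem unitary_diagonal {n : ℕ} (x : Matrix.unitaryGroup (Fin n) ℂ)
    (e : Fin n → ℂ) (h : (x : Matrix (Fin n) (Fin n) ℂ) = Matrix.diagonal e) :
    ∃ d, x = tor n d := by
  have hx := Matrix.mem_unitaryGroup_iff.1 x.2
  rw [h, Matrix.star_eq_conjTranspose, Matrix.diagonal_conjTranspose,
      Matrix.diagonal_mul_diagonal, ← Matrix.diagonal_one] at hx
  have h2 := Matrix.diagonal_injective hx
  refine ⟨fun i => ⟨e i, ?_⟩, Subtype.ext ?_⟩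
  · have := congrFun h2 i
    simp only [Pi.star_apply, RCLike.star_def, Complex.mul_conj] at this
    rw [Submonoid.unitSphere, Submonoid.mem_mk, Subsemigroup.mem_mk, mem_sphere_zero_iff_norm, Complex.norm_def]
    have h3 : Complex.normSq (e i) = 1 := by exact_mod_cast this
    rw [h3, Real.sqrt_one]
  · rw [h]; rfl

theorem comm_tor {n : ℕ} (d : Fin n → Circle) (hd : Function.Injective d)
    (x : Matrix.unitaryGroup (Fin n) ℂ) (h : x * tor n d = tor n d * x) : ∃ e, x = tor n e := by
  apply unitary_diagonal x (fun i => (x : Matrix (Fin n) (Fin n) ℂ) i i)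
  have h1 := congrArg (fun x : Matrix.unitaryGroup (Fin n) ℂ => (x : Matrix (Fin n) (Fin n) ℂ)) h
  simp only [Submonoid.coe_mul, tor_coe] at h1
  ext i j
  by_cases hij : i = j
  · subst hij; simp
  rw [Matrix.diagonal_apply_ne _ hij]
  have h2 := congrFun (congrFun h1 i) j
  rw [Matrix.mul_diagonal, Matrix.diagonal_mul] at h2
  have h3 : ((d j : ℂ) - d i) * (x : Matrix (Fin n) (Fin n) ℂ) i j = 0 := by
    linear_combination h2
  rcases mul_eq_zero.1 h3 with h4 | h4
  · exact absurd (hd (Circle.ext (sub_eq_zero.1 h4))).symm hij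
  · exact h4

theorem circle_infinite : Infinite Circle := by
  apply Infinite.of_injective (fun n : ℕ => Circle.exp (1 / (n + 1 : ℝ)))
  intro a b h
  simp only [Circle.exp_eq_exp] at h
  obtain ⟨m, hm⟩ := h
  have ha : 0 < (1 : ℝ) / (a + 1) := by positivity
  have hb : 0 < (1 : ℝ) / (b + 1) := by positivity
  have ha1 : (1 : ℝ) / (a + 1) ≤ 1 := by
    rw [div_le_one (by positivity)]; linarith [(Nat.cast_nonneg a : (0 : ℝ) ≤ a)]
  have hb1 : (1 : ℝ) / (b + 1) ≤ 1 := by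
    rw [div_le_one (by positivity)]; linarith [(Nat.cast_nonneg b : (0 : ℝ) ≤ b)]
  have hpi := Real.pi_gt_three
  have hm0 : m = 0 := by
    by_contra h0
    rcases lt_or_gt_of_ne h0 with h1 | h1
    · have : (m : ℝ) ≤ -1 := by exact_mod_cast Int.le_sub_one_of_lt h1
      nlinarith
    · have : (1 : ℝ) ≤ m := by exact_mod_cast h1
      nlinarith
  subst hm0
  simp only [Int.cast_zero, zero_mul, add_zero] at hm
  field_simp at hm
  have : (a : ℝ) = b := by linarith
  exact_mod_cast this

theorem exists_inj (n : ℕ) : ∃ d : Fin n → Circle, Function.Injective d := by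
  have := circle_infinite
  let f := Infinite.natEmbedding Circle
  exact ⟨fun i => f i, fun a b h => Fin.ext (f.injective h)⟩

theorem normalizer_perm {n : ℕ} (g : Matrix.unitaryGroup (Fin n) ℂ)
    (hg : ∀ d, ∃ e, g * tor n d * g⁻¹ = tor n e) :
    ∃ π : Equiv.Perm (Fin n), ∀ d, g * tor n d * g⁻¹ = tor n (d ∘ π) := by
  have hent : ∀ d e, g * tor n d * g⁻¹ = tor n e → ∀ j k,
      (g : Matrix (Fin n) (Fin n) ℂ) j k ≠ 0 → d k = e j := by
    intro d e h j k hjk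
    rw [mul_inv_eq_iff_eq_mul] at h
    have h1 := congrArg
      (fun x : Matrix.unitaryGroup (Fin n) ℂ => (x : Matrix (Fin n) (Fin n) ℂ) j k) h
    simp only [Submonoid.coe_mul, tor_coe, Matrix.mul_diagonal, Matrix.diagonal_mul] at h1
    rw [mul_comm] at h1
    exact Circle.ext (mul_right_cancel₀ hjk h1)
  have hdet : IsUnit (g : Matrix (Fin n) (Fin n) ℂ).det := by
    rw [← Matrix.isUnit_iff_isUnit_det]
    exact ⟨Unitary.toUnits g, rfl⟩
  have hrow : ∀ j, ∃ k, (g : Matrix (Fin n) (Fin n) ℂ) j k ≠ 0 := by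
    intro j
    by_contra! h
    exact hdet.ne_zero (Matrix.det_eq_zero_of_row_eq_zero j h)
  have hcol : ∀ k, ∃ j, (g : Matrix (Fin n) (Fin n) ℂ) j k ≠ 0 := by
    intro j
    by_contra! h
    exact hdet.ne_zero (Matrix.det_eq_zero_of_column_eq_zero j h)
  choose p hp using hrow
  obtain ⟨d0, hd0⟩ := exists_inj n
  obtain ⟨e0, he0⟩ := hg d0
  have hsurj : Function.Surjective p := by
    intro k
    obtain ⟨j, hj⟩ := hcol k
    refine ⟨j, hd0 ?_⟩
    rw [hent d0 e0 he0 j _ (hp j), hent d0 e0 he0 j _ hj]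
  refine ⟨Equiv.ofBijective p (Finite.surjective_iff_bijective.1 hsurj), fun d => ?_⟩
  obtain ⟨e, he⟩ := hg d
  rw [he]
  congr 1
  ext j
  simp [hent d e he j _ (hp j)]

theorem exists_diag {n : ℕ} (x : Matrix.unitaryGroup (Fin n) ℂ) :
    ∃ (u : Matrix.unitaryGroup (Fin n) ℂ) (d : Fin n → Circle), x = u * tor n d * u⁻¹ := by
  have := circle_infinite
  let X : Matrix (Fin n) (Fin n) ℂ := x
  obtain ⟨w', hw⟩ : ∃ w : Circle, (w : ℂ) ∉ X.charpoly.roots.toFinset := by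
    by_contra! h
    have hfin : (Set.range (fun w : Circle => (w : ℂ))).Finite :=
      (X.charpoly.roots.toFinset.finite_toSet).subset (by rintro _ ⟨w, rfl⟩; exact h w)
    have hinj : Function.Injective (fun w : Circle => (w : ℂ)) := fun a b h => Circle.ext h
    exact Set.infinite_range_of_injective hinj hfin
  obtain ⟨w, hw, hww⟩ : ∃ w : ℂ, w ∉ X.charpoly.roots.toFinset ∧ (starRingEnd ℂ) w * w = 1 := by
    refine ⟨w', hw, ?_⟩
    rw [mul_comm, Complex.mul_conj]; simp
  have hdet : (Matrix.scalar (Fin n) w - X).det ≠ 0 := by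
    intro h
    apply hw
    rw [Multiset.mem_toFinset, Polynomial.mem_roots (Matrix.charpoly_monic X).ne_zero,
      Polynomial.IsRoot, Matrix.eval_charpoly, h]
  let M : Matrix (Fin n) (Fin n) ℂ := w • 1 - X
  have hM : IsUnit M.det := by
    rw [isUnit_iff_ne_zero]
    convert hdet using 3
    ext i j
    simp [M, Matrix.scalar_apply, Matrix.diagonal_apply, Matrix.one_apply]
  have hX1 : star X * X = 1 := Matrix.mem_unitaryGroup_iff'.1 x.2
  have hX2 : X * star X = 1 := Matrix.mem_unitaryGroup_iff.1 x.2
  let H : Matrix (Fin n) (Fin n) ℂ := Complex.I • ((w • 1 + X) * M⁻¹)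
  have hHM : H * M = Complex.I • (w • 1 + X) := by
    simp only [H, Matrix.smul_mul]
    rw [Matrix.nonsing_inv_mul_cancel_right _ _ hM]
  have hMinv : IsUnit (star M).det := by
    rw [Matrix.star_eq_conjTranspose, Matrix.det_conjTranspose]
    exact hM.star
  have hH : H.IsHermitian := by
    have h1 : star M * star H = -Complex.I • (star w • 1 + star X) := by
      rw [← star_mul, hHM]
      simp [star_smul]
    have e1 : Complex.I * w * (starRingEnd ℂ) w = Complex.I := by
      linear_combination Complex.I * hww
    have e2 : w * (Complex.I * (starRingEnd ℂ) w) = Complex.I := by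
      linear_combination Complex.I * hww
    have h2 : star M * H * M = star M * star H * M := by
      rw [h1, mul_assoc, hHM]
      simp only [M, star_sub, star_smul, star_one, Matrix.mul_smul, Matrix.smul_mul, sub_mul,
        mul_sub, mul_add, add_mul, one_mul, mul_one, hX1, smul_add, smul_sub, smul_smul,
        RCLike.star_def, neg_smul, neg_mul]
      rw [e1, e2]
      module
    have h3 : star M * (H * M) = star M * (star H * M) := by
      rw [← mul_assoc, ← mul_assoc]; exact h2
    have h4 : H * M = star H * M := by
      have := congrArg (fun Y => (star M)⁻¹ * Y) h3
      simpa [Matrix.nonsing_inv_mul_cancel_left _ _ hMinv] using this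
    have h5 : H = star H := by
      have := congrArg (fun Y => Y * M⁻¹) h4
      simpa [Matrix.mul_nonsing_inv_cancel_right _ _ hM] using this
    exact h5.symm
  let u := hH.eigenvectorUnitary
  let y : Matrix.unitaryGroup (Fin n) ℂ := u⁻¹ * x * u
  have hsp := hH.spectral_theorem
  rw [Unitary.conjStarAlgAut_apply] at hsp
  let D : Matrix (Fin n) (Fin n) ℂ := Matrix.diagonal (fun i => ((hH.eigenvalues i : ℝ) : ℂ))
  have hsp' : H = (u : Matrix (Fin n) (Fin n) ℂ) * D * star (u : Matrix (Fin n) (Fin n) ℂ) := hsp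
  have hu1 : star (u : Matrix (Fin n) (Fin n) ℂ) * u = 1 := Matrix.mem_unitaryGroup_iff'.1 u.2
  have hy : (y : Matrix (Fin n) (Fin n) ℂ) = star (u : Matrix (Fin n) (Fin n) ℂ) * X * u := rfl
  have hxu : X * (u : Matrix (Fin n) (Fin n) ℂ) = u * y := by
    have : x * u = u * y := by simp [y, mul_assoc]
    exact congrArg (fun x : Matrix.unitaryGroup (Fin n) ℂ => (x : Matrix (Fin n) (Fin n) ℂ)) this
  have hHu : star (u : Matrix (Fin n) (Fin n) ℂ) * H = D * star (u : Matrix (Fin n) (Fin n) ℂ) := by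
    rw [hsp', ← mul_assoc, ← mul_assoc, hu1, one_mul]
  have key : D * (w • 1 - (y : Matrix (Fin n) (Fin n) ℂ)) =
      Complex.I • (w • 1 + (y : Matrix (Fin n) (Fin n) ℂ)) := by
    have h1 : star (u : Matrix (Fin n) (Fin n) ℂ) * (H * M) * u =
        star (u : Matrix (Fin n) (Fin n) ℂ) * (Complex.I • (w • 1 + X)) * u := by rw [hHM]
    rw [← mul_assoc, hHu] at h1
    have e1 : star (u : Matrix (Fin n) (Fin n) ℂ) * M * u =
        w • 1 - (y : Matrix (Fin n) (Fin n) ℂ) := by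
      rw [hy]; simp only [M, mul_sub, sub_mul, Matrix.mul_smul, Matrix.smul_mul, mul_one, hu1]
    have e2 : star (u : Matrix (Fin n) (Fin n) ℂ) * (Complex.I • (w • 1 + X)) * u =
        Complex.I • (w • 1 + (y : Matrix (Fin n) (Fin n) ℂ)) := by
      rw [hy]; simp only [mul_add, add_mul, Matrix.mul_smul, Matrix.smul_mul, mul_one, hu1]
    rw [e2, mul_assoc, mul_assoc, ← mul_assoc (star (u : Matrix (Fin n) (Fin n) ℂ)), e1] at h1
    exact h1
  obtain ⟨d, hd⟩ : ∃ d, y = tor n d := by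
    apply unitary_diagonal y (fun i => (y : Matrix (Fin n) (Fin n) ℂ) i i)
    ext i j
    by_cases hij : i = j
    · subst hij; simp
    rw [Matrix.diagonal_apply_ne _ hij]
    have h1 := congrFun (congrFun key i) j
    simp only [D, Matrix.diagonal_mul, Matrix.sub_apply, Matrix.smul_apply, Matrix.add_apply,
      Matrix.one_apply_ne hij, smul_eq_mul, mul_zero, zero_sub, zero_add] at h1
    have h2 : (((hH.eigenvalues i : ℝ) : ℂ) + Complex.I) *
        (y : Matrix (Fin n) (Fin n) ℂ) i j = 0 := by linear_combination -h1
    rcases mul_eq_zero.1 h2 with h3 | h3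
    · have := congrArg Complex.im h3
      simp at this
    · exact h3
  refine ⟨u, d, ?_⟩
  rw [← hd]
  simp [y, mul_assoc]

/-- trace of an automorphism preserving the torus, on the torus -/
theorem trace_of_torus {n : ℕ} (hn : 2 ≤ n)
    (ψ : Matrix.unitaryGroup (Fin n) ℂ ≃* Matrix.unitaryGroup (Fin n) ℂ)
    (hψ : Continuous ψ)
    (hdet : ∀ x : Matrix.unitaryGroup (Fin n) ℂ,
      Matrix.det ((ψ x : Matrix (Fin n) (Fin n) ℂ)) =
        Matrix.det ((x : Matrix (Fin n) (Fin n) ℂ)))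
    (h1 : ∀ d, ∃ e, ψ (tor n d) = tor n e) (h2 : ∀ d, ∃ e, ψ.symm (tor n d) = tor n e)
    (d : Fin n → Circle) :
    Matrix.trace (ψ (tor n d) : Matrix (Fin n) (Fin n) ℂ) =
      Matrix.trace (tor n d : Matrix (Fin n) (Fin n) ℂ) := by
  choose f hf using h1
  choose f' hf' using h2
  let F : (Fin n → Circle) →* (Fin n → Circle) :=
    { toFun := f
      map_one' := by apply tor_injective; rw [← hf]; simp
      map_mul' := fun a b => by apply tor_injective; rw [← hf]; simp [hf] }
  have hF : ∀ d, tor n (F d) = ψ (tor n d) := fun d => (hf d).symm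
  have hinj : Function.Injective F := by
    intro a b h
    apply tor_injective
    apply ψ.injective
    rw [← hF, ← hF, h]
  have hcont : Continuous F := by
    apply continuous_pi
    intro i
    have hind : Topology.IsInducing (fun z : Circle => (z : ℂ)) := ⟨rfl⟩
    rw [hind.continuous_iff]
    have he : ((fun z : Circle => (z : ℂ)) ∘ fun a => F a i) =
        fun a => (ψ (tor n a) : Matrix (Fin n) (Fin n) ℂ) i i := by
      ext a
      rw [← hF, tor_coe, Matrix.diagonal_apply_eq]
      rfl
    rw [he]
    have ht : Continuous (tor n) := by
      rw [Topology.IsInducing.subtypeVal.continuous_iff]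
      exact Continuous.matrix_diagonal
        (continuous_pi fun i => hind.continuous.comp (continuous_apply i))
    exact (continuous_subtype_val.comp (hψ.comp ht)).matrix_elem i i
  have W1 : ∀ σ : Equiv.Perm (Fin n), ∃ π : Equiv.Perm (Fin n), ∀ d, F (d ∘ σ) = F d ∘ π := by
    intro σ
    obtain ⟨π, hπ⟩ := normalizer_perm (ψ (pm σ)) (by
      intro d
      refine ⟨F (f' d ∘ σ), ?_⟩
      rw [hF, ← pm_mul_tor, map_mul, map_mul, map_inv, ← hf', MulEquiv.apply_symm_apply])
    refine ⟨π, fun d => tor_injective ?_⟩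
    rw [← hπ, hF, hF, ← pm_mul_tor, map_mul, map_mul, map_inv]
  have W2 : ∀ π : Equiv.Perm (Fin n), ∃ σ : Equiv.Perm (Fin n), ∀ d, F (d ∘ σ) = F d ∘ π := by
    intro π
    obtain ⟨σ, hσ⟩ := normalizer_perm (ψ.symm (pm π)) (by
      intro d
      refine ⟨f' (F d ∘ π), ?_⟩
      rw [← hf', ← pm_mul_tor, map_mul, map_mul, map_inv, hF, MulEquiv.symm_apply_apply])
    refine ⟨σ, fun d => tor_injective ?_⟩
    rw [hF, ← hσ, map_mul, map_mul, map_inv, MulEquiv.apply_symm_apply, ← pm_mul_tor, hF]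
  have hd : ∀ d, ∏ i, F d i = ∏ i, d i := by
    intro d
    have := hdet (tor n d)
    rw [← hF, tor_coe, tor_coe, Matrix.det_diagonal, Matrix.det_diagonal] at this
    apply Circle.ext
    have e1 := map_prod Circle.coeHom (F d) Finset.univ
    have e2 := map_prod Circle.coeHom d Finset.univ
    exact e1.trans (this.trans e2.symm)
  rw [← hF, tor_coe, tor_coe, Matrix.trace_diagonal, Matrix.trace_diagonal]
  exact torus_lemma n hn F hinj hcont W1 W2 hd d

theorem trace_conj {n : ℕ} (u x : Matrix.unitaryGroup (Fin n) ℂ) :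
    Matrix.trace ((u * x * u⁻¹ : Matrix.unitaryGroup (Fin n) ℂ) : Matrix (Fin n) (Fin n) ℂ) =
      Matrix.trace (x : Matrix (Fin n) (Fin n) ℂ) := by
  rw [Submonoid.coe_mul, Matrix.trace_mul_comm, ← Submonoid.coe_mul, inv_mul_cancel_left]

theorem det_conj {n : ℕ} (u x : Matrix.unitaryGroup (Fin n) ℂ) :
    Matrix.det ((u * x * u⁻¹ : Matrix.unitaryGroup (Fin n) ℂ) : Matrix (Fin n) (Fin n) ℂ) =
      Matrix.det (x : Matrix (Fin n) (Fin n) ℂ) := by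
  rw [Submonoid.coe_mul, Matrix.det_mul_comm, ← Submonoid.coe_mul, inv_mul_cancel_left]

theorem trace_preserved {n : ℕ}
    (φ : Matrix.unitaryGroup (Fin n) ℂ ≃* Matrix.unitaryGroup (Fin n) ℂ)
    (hφ : Continuous φ)
    (hdet : ∀ x : Matrix.unitaryGroup (Fin n) ℂ,
      Matrix.det ((φ x : Matrix (Fin n) (Fin n) ℂ)) =
        Matrix.det ((x : Matrix (Fin n) (Fin n) ℂ)))
    (x : Matrix.unitaryGroup (Fin n) ℂ) :
    Matrix.trace (φ x : Matrix (Fin n) (Fin n) ℂ) =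
      Matrix.trace (x : Matrix (Fin n) (Fin n) ℂ) := by
  rcases Nat.lt_or_ge n 2 with hn | hn
  · have h := hdet x
    interval_cases n
    · simp [Matrix.trace]
    · rw [Matrix.det_fin_one, Matrix.det_fin_one] at h
      rw [Matrix.trace_fin_one, Matrix.trace_fin_one, h]
  obtain ⟨d0, hd0⟩ := exists_inj n
  obtain ⟨u, d1, hu⟩ := exists_diag (φ (tor n d0))
  let ψ : Matrix.unitaryGroup (Fin n) ℂ ≃* Matrix.unitaryGroup (Fin n) ℂ :=
    φ.trans (MulAut.conj u⁻¹)
  have hψ : ∀ x, ψ x = u⁻¹ * φ x * u := by intro x; simp [ψ]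
  have hψ0 : ψ (tor n d0) = tor n d1 := by
    rw [hψ, hu]; simp [mul_assoc]
  -- the torus commutes
  have tcomm : ∀ a b, tor n a * tor n b = tor n b * tor n a := by
    intro a b; rw [← map_mul, ← map_mul, mul_comm]
  have h2 : ∀ d, ∃ e, ψ.symm (tor n d) = tor n e := by
    intro d
    apply comm_tor d0 hd0
    apply ψ.injective
    rw [map_mul, map_mul, hψ0, MulEquiv.apply_symm_apply, tcomm]
  have h1 : ∀ d, ∃ e, ψ (tor n d) = tor n e := by
    intro d
    apply comm_tor d0 hd0
    apply ψ.symm.injective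
    obtain ⟨e, he⟩ := h2 d0
    rw [map_mul, map_mul, he, MulEquiv.symm_apply_apply, tcomm]
  have hψc : Continuous ψ := by
    have : (ψ : Matrix.unitaryGroup (Fin n) ℂ → Matrix.unitaryGroup (Fin n) ℂ) =
      fun x => u⁻¹ * φ x * u := funext hψ
    rw [this, Topology.IsInducing.subtypeVal.continuous_iff]
    have h3 : Continuous fun x => (φ x : Matrix (Fin n) (Fin n) ℂ) :=
      continuous_subtype_val.comp hφ
    exact (continuous_const.matrix_mul h3).matrix_mul continuous_const
  have hψd : ∀ x : Matrix.unitaryGroup (Fin n) ℂ,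
      Matrix.det ((ψ x : Matrix (Fin n) (Fin n) ℂ)) =
        Matrix.det ((x : Matrix (Fin n) (Fin n) ℂ)) := by
    intro x
    have := det_conj u⁻¹ (φ x)
    rw [inv_inv, ← hψ] at this
    rw [this, hdet]
  obtain ⟨v, d, hv⟩ := exists_diag x
  have e1 := trace_conj u⁻¹ (φ x)
  rw [inv_inv, ← hψ] at e1
  rw [← e1, hv, map_mul, map_mul, map_inv, trace_conj, trace_conj]
  exact trace_of_torus hn ψ hψc hψd h1 h2 d

theorem adjoin_unitary {n : ℕ} (S : Subalgebra ℂ (Matrix (Fin n) (Fin n) ℂ))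
    (hS : ∀ x : Matrix.unitaryGroup (Fin n) ℂ, (x : Matrix (Fin n) (Fin n) ℂ) ∈ S) : S = ⊤ := by
  rw [eq_top_iff]
  intro M _
  have h1 : ∀ i, Matrix.single i i (1 : ℂ) ∈ S := by
    intro i
    have : Matrix.single i i (1 : ℂ) = (1 / 2 : ℂ) •
        (1 - (tor n (Pi.mulSingle i (-1)) : Matrix (Fin n) (Fin n) ℂ)) := by
      ext j k
      rw [tor_coe]
      by_cases hjk : j = k
      · subst hjk
        by_cases hij : i = j
        · subst hij; simp; norm_num
        · simp [Matrix.single_apply, hij, Pi.mulSingle_eq_of_ne (Ne.symm hij)]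
      · have : ¬ (i = j ∧ i = k) := fun h => hjk (h.1.symm.trans h.2)
        simp [Matrix.single_apply, this, hjk]
    rw [this]
    exact S.smul_mem (S.sub_mem S.one_mem (hS _)) _
  have h2 : ∀ i j, Matrix.single i j (1 : ℂ) ∈ S := by
    intro i j
    have : Matrix.single i j (1 : ℂ) =
        Matrix.single i i 1 * (pm (Equiv.swap i j) : Matrix (Fin n) (Fin n) ℂ) := by
      ext a b
      by_cases h : a = i
      · subst h
        simp [pm, Matrix.single_apply, Equiv.Perm.permMatrix, PEquiv.toMatrix_apply, eq_comm]
      · simp [h, Matrix.single_apply, Ne.symm h]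
    rw [this]
    exact S.mul_mem (h1 i) (hS _)
  rw [Matrix.matrix_eq_sum_single M]
  refine S.sum_mem fun i _ => S.sum_mem fun j _ => ?_
  have : Matrix.single i j (M i j) = (M i j) • Matrix.single i j (1 : ℂ) := by simp
  rw [this]
  exact S.smul_mem (h2 i j) _

theorem exists_intertwiner {n : ℕ}
    (φ : Matrix.unitaryGroup (Fin n) ℂ ≃* Matrix.unitaryGroup (Fin n) ℂ)
    (htr : ∀ x, Matrix.trace (φ x : Matrix (Fin n) (Fin n) ℂ) =
      Matrix.trace (x : Matrix (Fin n) (Fin n) ℂ)) :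
    ∃ s : Matrix (Fin n) (Fin n) ℂ, IsUnit s ∧
      ∀ x, (φ x : Matrix (Fin n) (Fin n) ℂ) * s = s * (x : Matrix (Fin n) (Fin n) ℂ) := by
  let G := Matrix.unitaryGroup (Fin n) ℂ
  let Mn := Matrix (Fin n) (Fin n) ℂ
  let j : G →* Mn := (Matrix.unitaryGroup (Fin n) ℂ).subtype
  let L1 : MonoidAlgebra ℂ G →ₐ[ℂ] Mn := MonoidAlgebra.lift ℂ Mn G j
  let L2 : MonoidAlgebra ℂ G →ₐ[ℂ] Mn := MonoidAlgebra.lift ℂ Mn G (j.comp φ.toMonoidHom)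
  have hL1 : ∀ g : G, L1 (MonoidAlgebra.of ℂ G g) = (g : Mn) := by
    intro g; simp [L1, j]
  have hL2 : ∀ g : G, L2 (MonoidAlgebra.of ℂ G g) = (φ g : Mn) := by
    intro g; simp [L2, j]
  have hs1 : Function.Surjective L1 := by
    rw [← AlgHom.range_eq_top]
    exact adjoin_unitary _ fun x => ⟨_, hL1 x⟩
  have hs2 : Function.Surjective L2 := by
    rw [← AlgHom.range_eq_top]
    refine adjoin_unitary _ fun x => ⟨MonoidAlgebra.of ℂ G (φ.symm x), ?_⟩
    have := hL2 (φ.symm x)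
    rw [MulEquiv.apply_symm_apply] at this
    exact this
  have ht : ∀ a, Matrix.trace (L2 a) = Matrix.trace (L1 a) := by
    intro a
    induction a using MonoidAlgebra.induction_on with
    | of g => rw [hL1, hL2, htr]
    | add a b ha hb => rw [map_add, map_add, Matrix.trace_add, Matrix.trace_add, ha, hb]
    | smul c a ha => rw [map_smul, map_smul, Matrix.trace_smul, Matrix.trace_smul, ha]
  have hker : ∀ a, L1 a = 0 ↔ L2 a = 0 := by
    intro a
    constructor
    · intro h
      rw [Matrix.ext_iff_trace_mul_right]
      intro y
      obtain ⟨b, rfl⟩ := hs2 y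
      rw [← map_mul, ht, map_mul, h]; simp
    · intro h
      rw [Matrix.ext_iff_trace_mul_right]
      intro y
      obtain ⟨b, rfl⟩ := hs1 y
      rw [← map_mul, ← ht, map_mul, h]; simp
  have heq : ∀ a b, L1 a = L1 b ↔ L2 a = L2 b := by
    intro a b
    rw [← sub_eq_zero, ← map_sub, hker, map_sub, sub_eq_zero]
  choose g hg using hs1
  have hΦ : ∀ a, L2 (g (L1 a)) = L2 a := fun a => (heq _ _).1 (hg _)
  let Φ : Mn →ₐ[ℂ] Mn := AlgHom.ofLinearMap
    { toFun := fun y => L2 (g y)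
      map_add' := fun x y => by
        rw [← map_add, ← heq, map_add, hg, hg, hg]
      map_smul' := fun c x => by
        rw [RingHom.id_apply, ← map_smul, ← heq, map_smul, hg, hg] }
    (by
      change L2 (g 1) = 1
      refine ((heq _ 1).1 ?_).trans (map_one L2)
      rw [hg]
      exact (map_one L1).symm)
    (fun x y => by
      change L2 (g (x * y)) = L2 (g x) * L2 (g y)
      rw [← map_mul, ← heq, map_mul, hg, hg, hg])
  have hΦa : ∀ y, Φ y = L2 (g y) := fun _ => rfl
  have hbij : Function.Bijective Φ := by
    constructor
    · intro x y h
      rw [hΦa, hΦa, ← heq, hg, hg] at h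
      exact h
    · intro y
      obtain ⟨b, rfl⟩ := hs2 y
      exact ⟨L1 b, hΦ b⟩
  let E : Mn ≃ₐ[ℂ] Mn := AlgEquiv.ofBijective Φ hbij
  have hE : ∀ x : G, E (x : Mn) = (φ x : Mn) := by
    intro x
    change Φ _ = _
    rw [hΦa, ← hL1 x, hΦ, hL2]
  let t : Mn ≃ₐ[ℂ] ((Fin n → ℂ) →ₗ[ℂ] (Fin n → ℂ)) := Matrix.toLinAlgEquiv'
  obtain ⟨T, hT⟩ := AlgEquiv.eq_linearEquivConjAlgEquiv ((t.symm.trans E).trans t)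
  have hT' : ∀ x : G, t (φ x : Mn) * T.toLinearMap = T.toLinearMap * t (x : Mn) := by
    intro x
    have h1 : t (E (x : Mn)) = T.conjAlgEquiv ℂ (t (x : Mn)) := by
      rw [← hT]; simp
    rw [← hE, h1]
    ext v
    simp [LinearEquiv.conjAlgEquiv_apply]
  refine ⟨t.symm T.toLinearMap, ?_, ?_⟩
  · rw [isUnit_iff_exists]
    refine ⟨t.symm T.symm.toLinearMap, ?_, ?_⟩
    · rw [← map_mul]
      convert map_one t.symm
      ext; simp
    · rw [← map_mul]
      convert map_one t.symm
      ext; simp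
  · intro x
    apply t.injective
    rw [map_mul, map_mul, AlgEquiv.apply_symm_apply]
    exact hT' x


theorem det_fixing_automorphism_of_unitary_is_inner
    (n : ℕ)
    (φ : Matrix.unitaryGroup (Fin n) ℂ ≃* Matrix.unitaryGroup (Fin n) ℂ)
    (hφ : Continuous φ)
    (hdet : ∀ x : Matrix.unitaryGroup (Fin n) ℂ,
      Matrix.det ((φ x : Matrix (Fin n) (Fin n) ℂ)) =
        Matrix.det ((x : Matrix (Fin n) (Fin n) ℂ))) :
    ∃ u : Matrix.unitaryGroup (Fin n) ℂ, ∀ x, φ x = u * x * u⁻¹ := by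
  obtain ⟨s, hs, hsx⟩ := exists_intertwiner φ (trace_preserved φ hφ hdet)
  rcases Nat.eq_zero_or_pos n with rfl | hn
  · exact ⟨1, fun x => Subtype.ext (Subsingleton.elim _ _)⟩
  -- `star s * s` is scalar
  have hstar : ∀ x : Matrix.unitaryGroup (Fin n) ℂ,
      star s * (φ x : Matrix (Fin n) (Fin n) ℂ) = (x : Matrix (Fin n) (Fin n) ℂ) * star s := by
    intro x
    have h := congrArg star (hsx x⁻¹)
    rw [star_mul, star_mul, map_inv] at h
    simpa [Matrix.UnitaryGroup.inv_val] using h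
  have hcent : ∀ x : Matrix.unitaryGroup (Fin n) ℂ,
      (x : Matrix (Fin n) (Fin n) ℂ) * (star s * s) =
        (star s * s) * (x : Matrix (Fin n) (Fin n) ℂ) := by
    intro x
    rw [← mul_assoc, ← hstar, mul_assoc, hsx, mul_assoc]
  have hall : Subalgebra.centralizer ℂ {star s * s} = (⊤ : Subalgebra ℂ _) := by
    apply adjoin_unitary
    intro x
    rw [Subalgebra.mem_centralizer_iff]
    rintro y rfl
    exact (hcent x).symm
  have hcomm : ∀ M : Matrix (Fin n) (Fin n) ℂ, Commute M (star s * s) := by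
    intro M
    have : M ∈ Subalgebra.centralizer ℂ {star s * s} := by rw [hall]; trivial
    rw [Subalgebra.mem_centralizer_iff] at this
    exact (this _ rfl).symm
  obtain ⟨r, hr⟩ := Matrix.mem_range_scalar_of_commute_single
    (M := star s * s) (fun i j _ => hcomm _)
  let i0 : Fin n := ⟨0, hn⟩
  have hr1 : r = ((∑ k, ‖s k i0‖ ^ 2 : ℝ) : ℂ) := by
    have h := congrFun (congrFun hr i0) i0
    rw [Matrix.scalar_apply, Matrix.diagonal_apply_eq, Matrix.mul_apply] at h
    rw [h]
    push_cast
    apply Finset.sum_congr rfl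
    intro k _
    rw [Matrix.star_apply, RCLike.star_def, ← Complex.conj_mul']
  set ρ : ℝ := ∑ k, ‖s k i0‖ ^ 2 with hρ
  have hρ0 : ρ ≠ 0 := by
    intro h0
    rw [h0] at hr1
    have hz : star s * s = 0 := by rw [← hr, hr1]; simp
    have hu : IsUnit (star s * s) := hs.star.mul hs
    rw [hz] at hu
    have : Nonempty (Fin n) := ⟨i0⟩
    exact not_isUnit_zero hu
  have hρpos : 0 < ρ := lt_of_le_of_ne (Finset.sum_nonneg fun k _ => by positivity) hρ0.symm
  let c : ℂ := ((Real.sqrt ρ)⁻¹ : ℝ)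
  have hc : star c * c * r = 1 := by
    simp only [c, hr1, RCLike.star_def, Complex.conj_ofReal]
    norm_cast
    have := Real.mul_self_sqrt hρpos.le
    have h3 : Real.sqrt ρ ≠ 0 := (Real.sqrt_pos.2 hρpos).ne'
    field_simp
    rw [sq, this]
  have hu : c • s ∈ Matrix.unitaryGroup (Fin n) ℂ := by
    rw [Matrix.mem_unitaryGroup_iff', star_smul, Matrix.smul_mul, Matrix.mul_smul, ← hr,
      smul_smul]
    ext i j
    by_cases hij : i = j
    · subst hij
      simpa [Matrix.scalar_apply] using hc
    · simp [Matrix.scalar_apply, hij]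
  refine ⟨⟨c • s, hu⟩, fun x => ?_⟩
  rw [eq_mul_inv_iff_mul_eq]
  apply Subtype.ext
  rw [Submonoid.coe_mul, Submonoid.coe_mul]
  simp only [Matrix.mul_smul, Matrix.smul_mul, hsx]
end
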